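/- arXiv:1604.01925 — 9 statements merged into one kernel-verified Lean document; each statement's English description precedes it below -/
import Mathlib

section
/- Let q be a prime power, m a positive integer, and σ, δ ∈ (0,1) reals with δ < (1−σ)/2. Let d be a positive integer with d ≤ σ(q−1) − 1. Then the Reed-Muller code RM(q,d,m) is a (q−1, δ, 2δ/(1−σ))-locally correctable code. -/
open scoped BigOperators

/-- `C ⊆ F^I` is a `(k; r, δ, ε)`-locally correctable code: for every `S ⊆ I` with
`|S| ≤ k` there is a (finitely supported) probability distribution over pairs `(T, g)`,
`T ⊆ I` with `|T| ≤ r` and `g : (T → F) → (S → F)`, such that for every codeword `c ∈ C`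
and every `y` within relative Hamming distance `δ` of `c`, the probability that
`g (y|_T) = c|_S` is at least `1 - ε`. -/
def LocallyCorrectable {F I : Type*} [Fintype F] [DecidableEq F] [Fintype I]
    (C : Set (I → F)) (k r : ℕ) (δ ε : ℝ) : Prop :=
  ∀ S : Finset I, S.card ≤ k →
    ∃ D : PMF ((T : Finset I) × ((↥T → F) → (↥S → F))),
      (∀ p ∈ D.support, p.1.card ≤ r) ∧
      ∀ c ∈ C, ∀ y : I → F,
        (hammingDist y c : ℝ) ≤ δ * (Fintype.card I) →
          ENNReal.ofReal (1 - ε) ≤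
            D.toOuterMeasure {p | p.2 (fun t => y t.1) = fun s => c s.1}

/-- The Reed-Muller code `RM(q,d,m)`: evaluation vectors over `F^m` of `m`-variate
polynomials of total degree at most `d`. -/
def ReedMullerCode (F : Type*) [CommSemiring F] (d m : ℕ) : Set ((Fin m → F) → F) :=
  {w | ∃ f : MvPolynomial (Fin m) F, f.totalDegree ≤ d ∧ ∀ u, MvPolynomial.eval u f = w u}

open Polynomial in
/-- Unique decoding of Reed-Solomon codes: two polynomials of degree at most `d` that are both
close to the same word `h` on the nonzero points of `F` coincide. -/
theorem reedSolomon_unique {F : Type*} [Field F] [Fintype F] [DecidableEq F] {d : ℕ}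
    {h : Fˣ → F} {p p' : F[X]} (hp : p.natDegree ≤ d) (hp' : p'.natDegree ≤ d)
    (he : 2 * hammingDist h (fun a : Fˣ => p.eval (a : F)) + d < Fintype.card Fˣ)
    (he' : 2 * hammingDist h (fun a : Fˣ => p'.eval (a : F)) + d < Fintype.card Fˣ) :
    p = p' := by
  by_contra hne
  have hne' : p - p' ≠ 0 := sub_ne_zero.mpr hne
  have hdist : (Finset.univ.filter fun a : Fˣ => ¬p.eval (a : F) = p'.eval (a : F)).card ≤
      hammingDist h (fun a : Fˣ => p.eval (a : F)) +
        hammingDist h (fun a : Fˣ => p'.eval (a : F)) := by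
    rw [hammingDist_comm h fun a : Fˣ => p.eval (a : F)]
    exact hammingDist_triangle (fun a : Fˣ => p.eval (a : F)) h fun a : Fˣ => p'.eval (a : F)
  have hcard : (Finset.univ.filter fun a : Fˣ => p.eval (a : F) = p'.eval (a : F)).card ≤ d := by
    rw [← Finset.card_map ⟨((↑) : Fˣ → F), Units.val_injective⟩]
    refine (Polynomial.card_le_degree_of_subset_roots (p := p - p') ?_).trans
      ((natDegree_sub_le _ _).trans (max_le hp hp'))
    intro x hx
    obtain ⟨a, ha, rfl⟩ := Finset.mem_map.mp hx
    simpa [hne', IsRoot, sub_eq_zero] using ha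
  have hsum := Finset.card_filter_add_card_filter_not (s := (Finset.univ : Finset Fˣ))
    (fun a : Fˣ => p.eval (a : F) = p'.eval (a : F))
  rw [Finset.card_univ] at hsum
  omega

open Polynomial Classical in
/-- The value at `0` of the polynomial of degree at most `d` obtained by uniquely decoding the
word `h` on the nonzero points of `F`, with junk value `0` if there is none. -/
noncomputable def reedSolomonDecode {F : Type*} [Field F] [Fintype F] [DecidableEq F]
    (d : ℕ) (h : Fˣ → F) : F :=
  if H : ∃ p : F[X], p.natDegree ≤ d ∧
      2 * hammingDist h (fun a : Fˣ => p.eval (a : F)) + d < Fintype.card Fˣ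
  then H.choose.eval 0 else 0

open Polynomial in
theorem reedSolomonDecode_eq {F : Type*} [Field F] [Fintype F] [DecidableEq F] {d : ℕ}
    {h : Fˣ → F} {p : F[X]} (hp : p.natDegree ≤ d)
    (he : 2 * hammingDist h (fun a : Fˣ => p.eval (a : F)) + d < Fintype.card Fˣ) :
    reedSolomonDecode d h = p.eval 0 := by
  have H : ∃ p : F[X], p.natDegree ≤ d ∧
      2 * hammingDist h (fun a : Fˣ => p.eval (a : F)) + d < Fintype.card Fˣ := ⟨p, hp, he⟩
  rw [reedSolomonDecode, dif_pos H,
    reedSolomon_unique H.choose_spec.1 hp H.choose_spec.2 he]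

open Polynomial in
/-- The restriction of a polynomial to a line is a univariate polynomial of no larger degree. -/
theorem exists_polynomial_eval_line {F ι : Type*} [CommRing F] {d : ℕ} (f : MvPolynomial ι F)
    (hf : f.totalDegree ≤ d) (w v : ι → F) :
    ∃ p : F[X], p.natDegree ≤ d ∧ ∀ a : F, p.eval a = MvPolynomial.eval (w + a • v) f := by
  refine ⟨MvPolynomial.aeval (fun i => C (v i) * X + C (w i)) f, ?_, fun a => ?_⟩
  · simpa using MvPolynomial.aeval_natDegree_le f hf (fun i => C (v i) * X + C (w i)) (n := 1)
      fun i => natDegree_linear_le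
  · rw [← Polynomial.coe_evalRingHom, MvPolynomial.aeval_def, MvPolynomial.hom_eval₂,
      MvPolynomial.eval, MvPolynomial.coe_eval₂Hom]
    congr 1
    · ext; simp
    · funext i
      simp only [coe_evalRingHom, eval_add, eval_mul, eval_C, eval_X, Pi.add_apply, Pi.smul_apply,
        smul_eq_mul]
      ring

/-- Double counting: the restrictions of two words to the punctured lines through `w` have
average relative distance equal to the relative distance of the words. -/
theorem sum_hammingDist_line {F ι : Type*} [Field F] [Fintype F] [DecidableEq F] [Fintype ι]
    [DecidableEq ι] (y c : (ι → F) → F) (w : ι → F) :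
    ∑ v : ι → F, hammingDist (fun a : Fˣ => y (w + (a : F) • v))
      (fun a : Fˣ => c (w + (a : F) • v)) = Fintype.card Fˣ * hammingDist y c := by
  have key (a : Fˣ) : (Finset.univ.filter fun v : ι → F =>
      y (w + (a : F) • v) ≠ c (w + (a : F) • v)).card = hammingDist y c := by
    refine Finset.card_equiv ((MulAction.toPerm a).trans (Equiv.addLeft w)) fun v => ?_
    simp only [Finset.mem_filter, Finset.mem_univ, true_and]
    rfl
  simp only [hammingDist, Finset.card_filter] at key ⊢
  rw [Finset.sum_comm, Finset.sum_congr rfl fun a _ => key a]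
  simp

/-- The decoder of the restriction of a received word to the punctured line through `w` in
direction `v`, together with the set of its queries. -/
noncomputable def lineDecoder {F ι : Type*} [Field F] [Fintype F] [DecidableEq F] [Fintype ι]
    (d : ℕ) (w v : ι → F) (S : Finset (ι → F)) :
    (T : Finset (ι → F)) × ((↥T → F) → (↥S → F)) :=
  ⟨Finset.univ.image fun a : Fˣ => w + (a : F) • v, fun z _ => reedSolomonDecode d fun a =>
    z ⟨w + (a : F) • v, Finset.mem_image_of_mem _ (Finset.mem_univ a)⟩⟩

theorem stmt_1 (q : ℕ) (F : Type) [Field F] [Fintype F] [DecidableEq F]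
    (hF : Fintype.card F = q) (m : ℕ) (hm : 0 < m)
    (σ δ : ℝ) (hσ : σ ∈ Set.Ioo (0 : ℝ) 1) (hδ : δ ∈ Set.Ioo (0 : ℝ) 1)
    (hδσ : δ < (1 - σ) / 2)
    (d : ℕ) (hd : 0 < d) (hdσ : (d : ℝ) ≤ σ * ((q : ℝ) - 1) - 1) :
    LocallyCorrectable (ReedMullerCode F d m) 1 (q - 1) δ (2 * δ / (1 - σ)) := by
  classical
  subst hF
  have hunits : Fintype.card Fˣ = Fintype.card F - 1 := Fintype.card_units F
  have hone : 1 < Fintype.card F := Fintype.one_lt_card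
  have hunitsR : (Fintype.card Fˣ : ℝ) = (Fintype.card F : ℝ) - 1 := by
    rw [hunits, Nat.cast_sub hone.le, Nat.cast_one]
  have hpos : (0 : ℝ) < Fintype.card Fˣ := by exact_mod_cast Fintype.card_pos
  have hσ' : 0 < 1 - σ := sub_pos.mpr hσ.2
  intro S hS
  rcases S.eq_empty_or_nonempty with rfl | hne
  · refine ⟨PMF.pure ⟨∅, fun _ _ => 0⟩, by simp, fun c _ y _ => ?_⟩
    refine (ENNReal.ofReal_le_one.mpr (sub_le_self _ (div_nonneg (by linarith [hδ.1])
      hσ'.le))).trans_eq ((PMF.toOuterMeasure_apply_eq_one_iff _ _).mpr fun _ _ => ?_).symm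
    exact funext fun s => absurd s.2 (Finset.notMem_empty _)
  obtain ⟨w, rfl⟩ := Finset.card_eq_one.mp (hS.antisymm hne.card_pos)
  refine ⟨(PMF.uniformOfFintype (Fin m → F)).map fun v => lineDecoder d w v {w}, ?_, ?_⟩
  · intro p hp
    obtain ⟨v, -, rfl⟩ := (PMF.mem_support_map_iff _ _ _).mp hp
    exact Finset.card_image_le.trans_eq (Finset.card_univ.trans hunits)
  rintro c ⟨f, hf, hfc⟩ y hy
  let e (v : Fin m → F) : ℕ := hammingDist (fun a : Fˣ => y (w + (a : F) • v))
      (fun a : Fˣ => c (w + (a : F) • v))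
  let good : Finset (Fin m → F) := {v | 2 * e v + d < Fintype.card Fˣ}
  have hgood : ∀ v ∈ good, (lineDecoder d w v {w}).2 (fun t => y t.1) = fun s => c s.1 := by
    intro v hv
    obtain ⟨p, hpd, hp⟩ := exists_polynomial_eval_line f hf w v
    have hpc (a : F) : p.eval a = c (w + a • v) := (hp a).trans (hfc _)
    funext s
    rw [Finset.mem_singleton.mp s.2]
    refine (reedSolomonDecode_eq hpd ?_).trans (by simp [hpc])
    simpa [hpc, good, e] using hv
  have hbad : ∀ v ∈ goodᶜ, (1 - σ) / 2 * Fintype.card Fˣ ≤ (e v : ℝ) := by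
    intro v hv
    have hv' : Fintype.card Fˣ ≤ 2 * e v + d := by simpa [good] using hv
    have hv'' : (Fintype.card Fˣ : ℝ) ≤ 2 * e v + d := by exact_mod_cast hv'
    rw [← hunitsR] at hdσ
    linarith
  have hsum : (∑ v, (e v : ℝ)) = Fintype.card Fˣ * (hammingDist y c : ℝ) := by
    exact_mod_cast sum_hammingDist_line y c w
  have hcount : (goodᶜ.card : ℝ) ≤ 2 * δ / (1 - σ) * Fintype.card (Fin m → F) := by
    have h₁ : (goodᶜ.card : ℝ) * ((1 - σ) / 2 * Fintype.card Fˣ) ≤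
        Fintype.card Fˣ * (δ * Fintype.card (Fin m → F)) := by
      calc (goodᶜ.card : ℝ) * ((1 - σ) / 2 * Fintype.card Fˣ)
          ≤ ∑ v ∈ goodᶜ, (e v : ℝ) := by
            simpa using Finset.card_nsmul_le_sum goodᶜ (fun v => (e v : ℝ)) _ hbad
        _ ≤ ∑ v, (e v : ℝ) :=
            Finset.sum_le_univ_sum_of_nonneg fun v => Nat.cast_nonneg _
        _ ≤ _ := by rw [hsum]; gcongr
    have h₂ : (goodᶜ.card : ℝ) * ((1 - σ) / 2) ≤ δ * Fintype.card (Fin m → F) :=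
      le_of_mul_le_mul_left (by linarith) hpos
    rw [div_mul_eq_mul_div, le_div_iff₀ hσ']
    linarith
  have hN : (0 : ℝ) < Fintype.card (Fin m → F) := by exact_mod_cast Fintype.card_pos
  have hprob : 1 - 2 * δ / (1 - σ) ≤ (good.card : ℝ) / Fintype.card (Fin m → F) := by
    have h : (good.card : ℝ) + goodᶜ.card = Fintype.card (Fin m → F) := by
      exact_mod_cast Finset.card_add_card_compl good
    rw [le_div_iff₀ hN]
    linarith
  rw [PMF.toOuterMeasure_map_apply]
  calc ENNReal.ofReal (1 - 2 * δ / (1 - σ))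
      ≤ ENNReal.ofReal ((good.card : ℝ) / Fintype.card (Fin m → F)) :=
        ENNReal.ofReal_le_ofReal hprob
    _ = (PMF.uniformOfFintype (Fin m → F)).toOuterMeasure good := by
        rw [PMF.toOuterMeasure_uniformOfFintype_apply, ENNReal.ofReal_div_of_pos hN,
          ENNReal.ofReal_natCast, ENNReal.ofReal_natCast]
        simp
    _ ≤ _ := MeasureTheory.measure_mono hgood
end

section
/- Let q be a prime power, m a positive integer, σ, δ ∈ (0,1) reals with δ < (1−σ)/2, and t an even integer with t ≥ 4. Let d be a positive integer with d·t ≤ σ(q−1) − 1. Then the Reed-Muller code RM(q,d,m) is a (q−1, δ, ε)-locally correctable code, where ε = 8·((4tδ(q−1) + 4t²)/((1−σ−2δ)²(q−1)²))^{t/2}. -/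
open scoped BigOperators

lemma seven_thirds_mul_pow_self_le (t : ℕ) (ht : 4 ≤ t) :
    (7 / 3 : ℝ) * (t : ℝ) ^ t ≤ ((t : ℝ) + 1) ^ t := by
  have key : ∀ (x : ℝ), 0 ≤ x → ∀ n : ℕ,
      1 + n * x + n * (n - 1) / 2 * x ^ 2 ≤ (1 + x) ^ n := by
    intro x hx n
    induction n with
    | zero => simp
    | succ k ih =>
      rw [pow_succ]
      have h := mul_le_mul_of_nonneg_right ih (by positivity : (0 : ℝ) ≤ 1 + x)
      refine le_trans ?_ h
      have hk : (0 : ℝ) ≤ k * (k - 1) := by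
        rcases k with _ | k
        · simp
        · push_cast; ring_nf; positivity
      push_cast
      nlinarith [mul_nonneg hk (pow_nonneg hx 3)]
  have ht' : (4 : ℝ) ≤ t := by exact_mod_cast ht
  have h0 : (0 : ℝ) < t := by linarith
  have h := key (1 / t) (by positivity) t
  have e : ((t : ℝ) + 1) ^ t = (1 + 1 / t) ^ t * (t : ℝ) ^ t := by
    rw [← mul_pow]; congr 1; field_simp
  rw [e]
  refine mul_le_mul_of_nonneg_right (le_trans ?_ h) (by positivity)
  field_simp
  linarith

lemma factorial_mul_pow_le (t : ℕ) (ht : 4 ≤ t) :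
    (t.factorial : ℝ) * (7 / 3) ^ t ≤ 4 * (t : ℝ) ^ t := by
  induction t, ht using Nat.le_induction with
  | base => norm_num [Nat.factorial]
  | succ t ht ih =>
    have h := seven_thirds_mul_pow_self_le t ht
    rw [Nat.factorial_succ, pow_succ, pow_succ]
    push_cast
    calc ((t : ℝ) + 1) * t.factorial * ((7 / 3) ^ t * (7 / 3))
        = ((t : ℝ) + 1) * (7 / 3) * (t.factorial * (7 / 3) ^ t) := by ring
      _ ≤ ((t : ℝ) + 1) * (7 / 3) * (4 * (t : ℝ) ^ t) := by gcongr
      _ = 4 * ((t : ℝ) + 1) * (7 / 3 * (t : ℝ) ^ t) := by ring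
      _ ≤ 4 * ((t : ℝ) + 1) * ((t + 1) ^ t) := by gcongr
      _ = _ := by ring

/-- The moment generating function of a centred binomial variable. -/
lemma sum_exp_centered_le {ι W : Type*} [Fintype ι] [DecidableEq ι] [Fintype W] [Nonempty W]
    [DecidableEq W] (B : Finset W) (x : ℝ) (hx : |x| ≤ 1) :
    ∑ ψ : ι → W, Real.exp (x * ∑ i, ((if ψ i ∈ B then 1 else 0) -
        (B.card : ℝ) / Fintype.card W)) ≤
      (Fintype.card W : ℝ) ^ Fintype.card ι *
        Real.exp (Fintype.card ι * ((B.card : ℝ) / Fintype.card W) * x ^ 2) := by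
  set p : ℝ := (B.card : ℝ) / Fintype.card W with hp
  have hW : (0 : ℝ) < Fintype.card W := by exact_mod_cast Fintype.card_pos
  have hp0 : 0 ≤ p := by positivity
  have one : ∑ w : W, Real.exp (x * ((if w ∈ B then 1 else 0) - p)) ≤
      Fintype.card W * Real.exp (p * x ^ 2) := by
    have e : ∀ w : W, Real.exp (x * ((if w ∈ B then 1 else 0) - p)) =
        Real.exp (-(x * p)) * (1 + (if w ∈ B then 1 else 0) * (Real.exp x - 1)) := by
      intro w
      split_ifs
      · rw [show x * (1 - p) = -(x * p) + x by ring, Real.exp_add]; ring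
      · simp
    simp_rw [e]
    rw [← Finset.mul_sum, Finset.sum_add_distrib, ← Finset.sum_mul]
    have hc : ∑ w : W, (if w ∈ B then (1 : ℝ) else 0) = p * Fintype.card W := by
      rw [hp]; field_simp; simp
    rw [hc]
    simp only [Finset.sum_const, Finset.card_univ, nsmul_eq_mul, mul_one]
    have h1 := (abs_le.mp (Real.abs_exp_sub_one_sub_id_le hx)).2
    have h2 : 1 + p * (Real.exp x - 1) ≤ Real.exp (p * (Real.exp x - 1)) := by
      linarith [Real.add_one_le_exp (p * (Real.exp x - 1))]
    calc Real.exp (-(x * p)) * (Fintype.card W + p * Fintype.card W * (Real.exp x - 1))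
        = Fintype.card W * (Real.exp (-(x * p)) * (1 + p * (Real.exp x - 1))) := by ring
      _ ≤ Fintype.card W * (Real.exp (-(x * p)) * Real.exp (p * (Real.exp x - 1))) := by gcongr
      _ = Fintype.card W * Real.exp (p * (Real.exp x - 1 - x)) := by
        rw [← Real.exp_add]; congr 2; ring
      _ ≤ _ := by gcongr
  have prod_form : ∑ ψ : ι → W, Real.exp (x * ∑ i, ((if ψ i ∈ B then 1 else 0) - p)) =
      (∑ w : W, Real.exp (x * ((if w ∈ B then 1 else 0) - p))) ^ Fintype.card ι := by
    simp_rw [Finset.mul_sum, Real.exp_sum]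
    rw [← Finset.card_univ (α := ι), ← Finset.prod_const, Finset.prod_univ_sum,
      Fintype.piFinset_univ]
  rw [prod_form]
  refine (pow_le_pow_left₀ (Finset.sum_nonneg fun _ _ => (Real.exp_pos _).le) one _).trans ?_
  rw [mul_pow, ← Real.exp_nat_mul, mul_assoc]

/-- An even central moment of a binomial variable. -/
lemma sum_centered_pow_le {ι W : Type*} [Fintype ι] [DecidableEq ι] [Fintype W] [Nonempty W]
    [DecidableEq W] (B : Finset W) (t : ℕ) (ht : 4 ≤ t) (hteven : Even t) :
    ∑ ψ : ι → W, (∑ i, ((if ψ i ∈ B then 1 else 0) - (B.card : ℝ) / Fintype.card W)) ^ t ≤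
      (Fintype.card W : ℝ) ^ Fintype.card ι *
        (8 * (t * (Fintype.card ι * ((B.card : ℝ) / Fintype.card W)) + (t : ℝ) ^ 2)
          ^ (t / 2)) := by
  set p : ℝ := (B.card : ℝ) / Fintype.card W with hp
  set N : ℝ := (Fintype.card W : ℝ) ^ Fintype.card ι with hN
  set μ : ℝ := Fintype.card ι * p with hμ
  have hp0 : 0 ≤ p := by positivity
  have hμ0 : 0 ≤ μ := by positivity
  have ht' : (4 : ℝ) ≤ t := by exact_mod_cast ht
  have h0 : (0 : ℝ) < t := by linarith
  have hN0 : 0 ≤ N := by positivity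
  set x : ℝ := Real.sqrt (t / (2 * (μ + t))) with hx
  have hx2 : x ^ 2 = t / (2 * (μ + t)) := Real.sq_sqrt (by positivity)
  have hx0 : 0 < x := Real.sqrt_pos.mpr (by positivity)
  have hx1 : |x| ≤ 1 := by
    rw [abs_of_pos hx0]
    refine Real.sqrt_le_one.mpr ?_
    rw [div_le_one (by positivity)]; linarith
  have hexp : μ * x ^ 2 ≤ t / 2 := by
    rw [hx2, mul_div_assoc', div_le_div_iff₀ (by positivity) (by norm_num)]
    nlinarith
  have hpt : ∀ z : ℝ, z ^ t ≤ t.factorial / x ^ t * (Real.exp (x * z) + Real.exp (-x * z)) := by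
    intro z
    have h := Real.pow_div_factorial_le_exp |x * z| (abs_nonneg _) t
    rw [hteven.pow_abs, mul_pow] at h
    have h2 : Real.exp |x * z| ≤ Real.exp (x * z) + Real.exp (-x * z) := by
      rcases abs_cases (x * z) with ⟨h, _⟩ | ⟨h, _⟩ <;> rw [h]
      · linarith [Real.exp_pos (-x * z)]
      · rw [neg_mul]; linarith [Real.exp_pos (x * z)]
    have hf : (0 : ℝ) < t.factorial := by exact_mod_cast t.factorial_pos
    have h3 := h.trans h2
    rw [div_le_iff₀ hf] at h3
    rw [div_mul_eq_mul_div, le_div_iff₀ (by positivity)]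
    linarith
  have hb : ∀ s : ℝ, |s| ≤ 1 → s ^ 2 = x ^ 2 →
      ∑ ψ : ι → W, Real.exp (s * ∑ i, ((if ψ i ∈ B then 1 else 0) - p)) ≤
        N * Real.exp (t / 2) := by
    intro s hs hs2
    refine (sum_exp_centered_le B s hs).trans ?_
    rw [hs2]
    gcongr
  obtain ⟨k, hk⟩ := hteven
  have hk2 : t / 2 = k := by omega
  have htk : t = 2 * k := by omega
  have hxt : x ^ t = ((t : ℝ) / (2 * (μ + t))) ^ k := by rw [← hx2, ← pow_mul, htk]
  have hE : Real.exp (t / 2) = Real.exp 1 ^ k := by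
    rw [← Real.exp_nat_mul, htk]; congr 1; push_cast; ring
  have hnum : (t.factorial : ℝ) / x ^ t * Real.exp (t / 2) ≤ 4 * (t * μ + (t : ℝ) ^ 2) ^ k := by
    have he : 2 * Real.exp 1 ≤ (7 / 3) ^ 2 := by linarith [Real.exp_one_lt_d9]
    have hfac := factorial_mul_pow_le t ht
    have e1 : ((7 : ℝ) / 3) ^ t = ((7 / 3) ^ 2) ^ k := by rw [← pow_mul, htk]
    have e2 : (t : ℝ) ^ t = ((t : ℝ) ^ 2) ^ k := by rw [← pow_mul, htk]
    rw [hxt, hE, div_pow, mul_pow, div_div_eq_mul_div, div_mul_eq_mul_div,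
      div_le_iff₀ (by positivity)]
    calc (t.factorial : ℝ) * (2 ^ k * (μ + t) ^ k) * Real.exp 1 ^ k
        = t.factorial * (2 * Real.exp 1) ^ k * (μ + t) ^ k := by rw [mul_pow]; ring
      _ ≤ t.factorial * ((7 / 3) ^ 2) ^ k * (μ + t) ^ k := by gcongr
      _ ≤ 4 * ((t : ℝ) ^ 2) ^ k * (μ + t) ^ k := by
        rw [← e1, ← e2]; gcongr
      _ = 4 * (t * μ + (t : ℝ) ^ 2) ^ k * t ^ k := by
        rw [mul_assoc, mul_assoc, ← mul_pow, ← mul_pow]; congr 2; ring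
  rw [hk2]
  calc _ ≤ ∑ ψ : ι → W, (t.factorial : ℝ) / x ^ t *
          (Real.exp (x * ∑ i, ((if ψ i ∈ B then 1 else 0) - p)) +
            Real.exp (-x * ∑ i, ((if ψ i ∈ B then 1 else 0) - p))) :=
        Finset.sum_le_sum fun ψ _ => hpt _
    _ ≤ (t.factorial : ℝ) / x ^ t * (N * Real.exp (t / 2) + N * Real.exp (t / 2)) := by
        rw [← Finset.mul_sum, Finset.sum_add_distrib]
        gcongr
        · exact hb x hx1 rfl
        · exact hb (-x) (by rwa [abs_neg]) (by ring)
    _ = 2 * N * ((t.factorial : ℝ) / x ^ t * Real.exp (t / 2)) := by ring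
    _ ≤ 2 * N * (4 * (t * μ + (t : ℝ) ^ 2) ^ k) := by gcongr
    _ = _ := by ring

/-- A surjective homomorphism of finite groups preserves averages. -/
lemma card_mul_sum_comp_of_surjective {G H : Type*} [AddGroup G] [AddGroup H] [Fintype G]
    [Fintype H] (f : G →+ H) (hf : Function.Surjective f) (h : H → ℝ) :
    (Fintype.card H : ℝ) * ∑ g, h (f g) = Fintype.card G * ∑ x, h x := by
  classical
  have hc : ∀ x : H, (Finset.univ.filter fun g => f g = x).card =
      (Finset.univ.filter fun g => f g = 0).card := fun x =>
    AddMonoidHom.card_fiber_eq_of_mem_range f (hf x) (hf 0)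
  have hsum : ∀ k : H → ℝ, ∑ g, k (f g) =
      (Finset.univ.filter fun g => f g = 0).card * ∑ x, k x := by
    intro k
    rw [← Finset.sum_fiberwise Finset.univ f, Finset.mul_sum]
    refine Finset.sum_congr rfl fun x _ => ?_
    rw [← hc x, ← nsmul_eq_mul, ← Finset.sum_const]
    refine Finset.sum_congr rfl fun g hg => ?_
    rw [(Finset.mem_filter.mp hg).2]
  have h1 := hsum fun _ => 1
  simp only [Finset.sum_const, Finset.card_univ, nsmul_eq_mul, mul_one] at h1
  rw [hsum h, h1]
  ring

/-- A family of random variables that is uniform on every set of at most `t` indices has the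
same `t`-th moments of sums as a fully independent uniform family. -/
lemma card_mul_sum_pow_eq_of_restrict_surjective {A ι W : Type*} [AddGroup A] [Fintype A]
    [Fintype ι] [DecidableEq ι] [AddGroup W] [Fintype W] (t : ℕ) (L : A →+ (ι → W))
    (hL : ∀ V : Finset ι, V.card ≤ t → ∀ w : ι → W, ∃ a, ∀ i ∈ V, L a i = w i) (h : W → ℝ) :
    (Fintype.card W : ℝ) ^ Fintype.card ι * ∑ a, (∑ i, h (L a i)) ^ t =
      Fintype.card A * ∑ ψ : ι → W, (∑ i, h (ψ i)) ^ t := by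
  classical
  simp_rw [Fintype.sum_pow]
  rw [Finset.sum_comm, Finset.sum_comm (s := (Finset.univ : Finset (ι → W))), Finset.mul_sum,
    Finset.mul_sum]
  refine Finset.sum_congr rfl fun τ _ => ?_
  set V : Finset ι := Finset.univ.image τ with hV
  have hVc : V.card ≤ t := Finset.card_image_le.trans (by simp)
  have hτ : ∀ j, τ j ∈ V := fun j => Finset.mem_image_of_mem _ (Finset.mem_univ _)
  let res : (ι → W) →+ (V → W) :=
    { toFun := fun ψ i => ψ i.1
      map_zero' := rfl
      map_add' := fun _ _ => rfl }
  have hext : ∀ w : V → W, ∃ ψ : ι → W, ∀ i : V, ψ i.1 = w i := fun w =>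
    ⟨fun i => if hi : i ∈ V then w ⟨i, hi⟩ else 0, fun i => by simp⟩
  have hres : Function.Surjective res := fun w => by
    obtain ⟨ψ, hψ⟩ := hext w
    exact ⟨ψ, funext hψ⟩
  have hresL : Function.Surjective (res.comp L) := fun w => by
    obtain ⟨ψ, hψ⟩ := hext w
    obtain ⟨a, ha⟩ := hL V hVc ψ
    exact ⟨a, funext fun i => (ha i.1 i.2).trans (hψ i)⟩
  let k : (V → W) → ℝ := fun w => ∏ j, h (w ⟨τ j, hτ j⟩)
  have e1 := card_mul_sum_comp_of_surjective (res.comp L) hresL k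
  have e2 := card_mul_sum_comp_of_surjective res hres k
  change _ * ∑ a, ∏ j, h (L a (τ j)) = _ at e1
  change _ * ∑ ψ : ι → W, ∏ j, h (ψ (τ j)) = _ at e2
  have hW : (0 : ℝ) < Fintype.card (V → W) := by exact_mod_cast Fintype.card_pos
  have e3 : (Fintype.card (ι → W) : ℝ) = (Fintype.card W : ℝ) ^ Fintype.card ι := by
    simp
  rw [e3] at e2
  apply mul_left_cancel₀ hW.ne'
  linear_combination (Fintype.card W : ℝ) ^ Fintype.card ι * e1 - Fintype.card A * e2

/-- The Bellare–Rompel tail bound for uniformly distributed `t`-wise independent points. -/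
lemma card_deviation_le {A ι W : Type*} [AddGroup A] [Fintype A]
    [Fintype ι] [DecidableEq ι] [AddGroup W] [Fintype W] [DecidableEq W] (t : ℕ) (ht : 4 ≤ t)
    (hteven : Even t) (L : A →+ (ι → W))
    (hL : ∀ V : Finset ι, V.card ≤ t → ∀ w : ι → W, ∃ a, ∀ i ∈ V, L a i = w i)
    (B : Finset W) (Δ : ℝ) (hΔ : 0 < Δ) :
    ((Finset.univ.filter fun a => Fintype.card ι * ((B.card : ℝ) / Fintype.card W) + Δ ≤
        ((Finset.univ.filter fun i => L a i ∈ B).card : ℝ)).card : ℝ) ≤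
      Fintype.card A * (8 * ((t * (Fintype.card ι * ((B.card : ℝ) / Fintype.card W)) +
        (t : ℝ) ^ 2) / Δ ^ 2) ^ (t / 2)) := by
  set p : ℝ := (B.card : ℝ) / Fintype.card W with hp
  set N : ℝ := (Fintype.card W : ℝ) ^ Fintype.card ι with hN
  have hN0 : 0 < N := by
    have : (0 : ℝ) < Fintype.card W := by exact_mod_cast Fintype.card_pos
    positivity
  have h1 := card_mul_sum_pow_eq_of_restrict_surjective t L hL
    fun w => (if w ∈ B then (1 : ℝ) else 0) - p
  have h2 := sum_centered_pow_le (ι := ι) B t ht hteven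
  rw [← hp, ← hN] at h2
  rw [← hN] at h1
  have h3 : ∑ a, (∑ i, ((if L a i ∈ B then (1 : ℝ) else 0) - p)) ^ t ≤
      Fintype.card A * (8 * (t * (Fintype.card ι * p) + (t : ℝ) ^ 2) ^ (t / 2)) := by
    refine le_of_mul_le_mul_left ?_ hN0
    rw [h1]
    calc _ ≤ (Fintype.card A : ℝ) * (N * _) := by gcongr
      _ = _ := by ring
  set S := Finset.univ.filter fun a => Fintype.card ι * p + Δ ≤
        ((Finset.univ.filter fun i => L a i ∈ B).card : ℝ) with hS
  have h4 : (S.card : ℝ) * Δ ^ t ≤ ∑ a, (∑ i, ((if L a i ∈ B then (1 : ℝ) else 0) - p)) ^ t := by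
    rw [← nsmul_eq_mul, ← Finset.sum_const]
    refine (Finset.sum_le_sum fun a ha => ?_).trans
      (Finset.sum_le_sum_of_subset_of_nonneg (Finset.subset_univ S)
        fun a _ _ => hteven.pow_nonneg _)
    refine pow_le_pow_left₀ hΔ.le ?_ t
    have := (Finset.mem_filter.mp ha).2
    rw [Finset.sum_sub_distrib, Finset.sum_boole]
    simp only [Finset.sum_const, Finset.card_univ, nsmul_eq_mul]
    linarith
  have htk : t = 2 * (t / 2) := (Nat.two_mul_div_two_of_even hteven).symm
  have h5 : Δ ^ t = (Δ ^ 2) ^ (t / 2) := by rw [← pow_mul, ← htk]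
  rw [div_pow, mul_div_assoc', mul_div_assoc', le_div_iff₀ (by positivity), ← h5]
  exact h4.trans h3

/-- The displacement `s ↦ ∑ aᵢ sⁱ⁺¹` of a curve from its base point, at nonzero parameters. -/
def curveDisplacement (F : Type*) [Field F] (t m : ℕ) :
    (Fin t → Fin m → F) →+ (Fˣ → Fin m → F) where
  toFun a s j := ∑ i, a i j * (s : F) ^ ((i : ℕ) + 1)
  map_zero' := by ext; simp
  map_add' a b := by ext; simp [add_mul, Finset.sum_add_distrib]

open Polynomial in
lemma exists_curveDisplacement_eq {F : Type*} [Field F] (t m : ℕ) (V : Finset Fˣ)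
    (hV : V.card ≤ t) (w : Fˣ → Fin m → F) :
    ∃ a, ∀ s ∈ V, curveDisplacement F t m a s = w s := by
  classical
  let P : Fin m → F[X] := fun j =>
    Lagrange.interpolate V (fun s : Fˣ => (s : F)) fun s => w s j * (s : F)⁻¹
  have hinj : Set.InjOn (fun s : Fˣ => (s : F)) V := Units.val_injective.injOn
  refine ⟨fun i j => (P j).coeff i, fun s hs => funext fun j => ?_⟩
  have heval : (P j).eval (s : F) = w s j * (s : F)⁻¹ :=
    Lagrange.eval_interpolate_at_node _ hinj hs
  have hdeg : (P j).degree < t :=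
    (Lagrange.degree_interpolate_lt _ hinj).trans_le (by exact_mod_cast hV)
  have ht : 0 < t := (Finset.card_pos.mpr ⟨s, hs⟩).trans_le hV
  have hnat : (P j).natDegree < t := by
    rcases eq_or_ne (P j) 0 with h | h
    · simpa [h] using ht
    · exact (natDegree_lt_iff_degree_lt h).mpr hdeg
  rw [eval_eq_sum_range' hnat, ← Fin.sum_univ_eq_sum_range
    (fun i => (P j).coeff i * (s : F) ^ i)] at heval
  change ∑ i : Fin t, (P j).coeff i * (s : F) ^ ((i : ℕ) + 1) = _
  simp_rw [pow_succ, ← mul_assoc]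
  rw [← Finset.sum_mul, heval, mul_assoc, inv_mul_cancel₀ s.ne_zero, mul_one]

open Polynomial in
lemma exists_polynomial_along_curve {F : Type*} [Field F] (t m d : ℕ)
    (f : MvPolynomial (Fin m) F) (hf : f.totalDegree ≤ d) (u : Fin m → F)
    (a : Fin t → Fin m → F) :
    ∃ P : F[X], P.natDegree ≤ d * t ∧ P.eval 0 = MvPolynomial.eval u f ∧
      ∀ s : Fˣ, P.eval (s : F) = MvPolynomial.eval (u + curveDisplacement F t m a s) f := by
  let c : Fin m → F[X] := fun j => C (u j) + ∑ i : Fin t, C (a i j) * X ^ ((i : ℕ) + 1)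
  have heval : ∀ x : F, (MvPolynomial.aeval c f).eval x =
      MvPolynomial.eval (fun j => (c j).eval x) f := by
    intro x
    have := MvPolynomial.map_aeval c (evalRingHom x) f
    rw [coe_evalRingHom] at this
    rw [this, MvPolynomial.eval]
    congr 1
    congr 1
    ext; simp
  refine ⟨MvPolynomial.aeval c f, MvPolynomial.aeval_natDegree_le f hf c fun j => ?_, ?_,
    fun s => ?_⟩
  · refine natDegree_add_le_of_degree_le (by simp) (natDegree_sum_le_of_forall_le _ _ fun i _ => ?_)
    exact (natDegree_C_mul_X_pow_le _ _).trans i.2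
  · rw [heval]; congr 2; ext j; simp [c, eval_finsetSum]
  · rw [heval]; congr 2; ext j; simp [c, eval_finsetSum, curveDisplacement]

open Polynomial in
lemma eq_of_few_disagreements {F : Type*} [Field F] [Fintype F] [DecidableEq F] (e : ℕ)
    (z : Fˣ → F) (P Q : F[X]) (hP : P.natDegree ≤ e) (hQ : Q.natDegree ≤ e)
    (hPz : 2 * (Finset.univ.filter fun s : Fˣ => z s ≠ P.eval (s : F)).card + e <
      Fintype.card Fˣ)
    (hQz : 2 * (Finset.univ.filter fun s : Fˣ => z s ≠ Q.eval (s : F)).card + e <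
      Fintype.card Fˣ) : P = Q := by
  classical
  set X := Finset.univ.filter fun s : Fˣ => z s ≠ P.eval (s : F)
  set Y := Finset.univ.filter fun s : Fˣ => z s ≠ Q.eval (s : F)
  have hc : (X ∪ Y)ᶜ.card + (X ∪ Y).card = Fintype.card Fˣ := Finset.card_compl_add_card _
  have hu := Finset.card_union_le X Y
  refine eq_of_natDegree_lt_card_of_eval_eq P Q (ι := ↥(X ∪ Y)ᶜ)
    (f := fun s => ((s : Fˣ) : F)) (Units.val_injective.comp Subtype.val_injective) ?_ ?_
  · rintro ⟨s, hs⟩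
    simp only [X, Y, Finset.mem_compl, Finset.mem_union, Finset.mem_filter, Finset.mem_univ,
      true_and, not_or, not_not] at hs
    exact hs.1.symm.trans hs.2
  · rw [Fintype.card_coe]
    omega

open Polynomial in
open scoped Classical in
/-- Unique decoding of a Reed–Solomon word of degree `e` at the nonzero elements, evaluated at
zero. -/
noncomputable def decodeAtZero {F : Type*} [Field F] [Fintype F] (e : ℕ) (z : Fˣ → F) : F :=
  if h : ∃ P : F[X], P.natDegree ≤ e ∧
      2 * (Finset.univ.filter fun s : Fˣ => z s ≠ P.eval (s : F)).card + e < Fintype.card Fˣ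
  then h.choose.eval 0 else 0

open Polynomial in
lemma decodeAtZero_eq {F : Type*} [Field F] [Fintype F] [DecidableEq F] (e : ℕ) (z : Fˣ → F)
    (P : F[X]) (hP : P.natDegree ≤ e)
    (hPz : 2 * (Finset.univ.filter fun s : Fˣ => z s ≠ P.eval (s : F)).card + e <
      Fintype.card Fˣ) : decodeAtZero e z = P.eval 0 := by
  classical
  have h : ∃ P : F[X], P.natDegree ≤ e ∧
      2 * (Finset.univ.filter fun s : Fˣ => z s ≠ P.eval (s : F)).card + e <
        Fintype.card Fˣ := ⟨P, hP, by convert hPz⟩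
  have hs := h.choose_spec
  rw [decodeAtZero, dif_pos (by convert h)]
  congr 1
  convert eq_of_few_disagreements e z _ P hs.1 hP (by convert hs.2) hPz

lemma ofReal_one_sub_le_toOuterMeasure_uniformOfFintype {A : Type*} [Fintype A] [Nonempty A]
    (S : Set A) (Z : Finset A) (hZ : ∀ a, a ∉ Z → a ∈ S) (ε : ℝ)
    (h : (Z.card : ℝ) ≤ Fintype.card A * ε) :
    ENNReal.ofReal (1 - ε) ≤ (PMF.uniformOfFintype A).toOuterMeasure S := by
  classical
  have hA : (0 : ℝ) < Fintype.card A := by exact_mod_cast Fintype.card_pos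
  rw [PMF.toOuterMeasure_uniformOfFintype_apply,
    ENNReal.le_div_iff_mul_le (by simp) (by simp), ← ENNReal.ofReal_natCast,
    ← ENNReal.ofReal_natCast, ← ENNReal.ofReal_mul' hA.le]
  refine ENNReal.ofReal_le_ofReal ?_
  have h1 : Zᶜ.card ≤ Fintype.card S := by
    rw [← Set.toFinset_card]
    exact Finset.card_le_card fun a ha => Set.mem_toFinset.mpr (hZ a (Finset.mem_compl.mp ha))
  have h2 : (Zᶜ.card : ℝ) + Z.card = Fintype.card A := by
    exact_mod_cast Finset.card_compl_add_card Z
  have h3 : (Zᶜ.card : ℝ) ≤ Fintype.card S := by exact_mod_cast h1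
  linarith

theorem stmt_3 (q : ℕ) (F : Type) [Field F] [Fintype F] [DecidableEq F]
    (hF : Fintype.card F = q) (m : ℕ) (hm : 0 < m)
    (σ δ : ℝ) (hσ : σ ∈ Set.Ioo (0 : ℝ) 1) (hδ : δ ∈ Set.Ioo (0 : ℝ) 1)
    (hδσ : δ < (1 - σ) / 2)
    (t : ℕ) (ht4 : 4 ≤ t) (hteven : Even t)
    (d : ℕ) (hd : 0 < d) (hdσ : ((d * t : ℕ) : ℝ) ≤ σ * ((q : ℝ) - 1) - 1) :
    LocallyCorrectable (ReedMullerCode F d m) 1 (q - 1) δ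
      (8 * ((4 * t * δ * ((q : ℝ) - 1) + 4 * (t : ℝ) ^ 2) /
        ((1 - σ - 2 * δ) ^ 2 * ((q : ℝ) - 1) ^ 2)) ^ (t / 2)) := by
  classical
  set ε : ℝ := 8 * ((4 * t * δ * ((q : ℝ) - 1) + 4 * (t : ℝ) ^ 2) /
        ((1 - σ - 2 * δ) ^ 2 * ((q : ℝ) - 1) ^ 2)) ^ (t / 2) with hε
  have hq1 : 1 < q := hF ▸ Fintype.one_lt_card
  have hcard : Fintype.card Fˣ = q - 1 := by rw [Fintype.card_units, hF]
  have hcardR : (Fintype.card Fˣ : ℝ) = (q : ℝ) - 1 := by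
    rw [hcard, Nat.cast_sub hq1.le, Nat.cast_one]
  have hn : (0 : ℝ) < (q : ℝ) - 1 := by
    have : (1 : ℝ) < q := by exact_mod_cast hq1
    linarith
  have hδ0 := hδ.1
  intro S hS
  rcases Finset.card_le_one_iff_subset_singleton.mp hS with ⟨u, hu⟩
  let L := curveDisplacement F t m
  let D : (Fin t → Fin m → F) →
      ((T : Finset (Fin m → F)) × ((↥T → F) → (↥S → F))) := fun a =>
    ⟨Finset.univ.image fun s => u + L a s, fun z _ => decodeAtZero (d * t)
      fun s => z ⟨u + L a s, Finset.mem_image_of_mem _ (Finset.mem_univ s)⟩⟩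
  refine ⟨(PMF.uniformOfFintype _).map D, ?_, ?_⟩
  · intro p hp
    obtain ⟨a, -, rfl⟩ := (PMF.mem_support_map_iff _ _ _).mp hp
    exact Finset.card_image_le.trans_eq (by rw [Finset.card_univ, hcard])
  rintro c ⟨f, hfd, hfc⟩ y hy
  rw [PMF.toOuterMeasure_map_apply]
  let B : Finset (Fin m → F) := Finset.univ.filter fun w => y (u + w) ≠ c (u + w)
  have hB : B.card = hammingDist y c := by
    rw [hammingDist]
    refine Finset.card_bij (fun w _ => u + w) (by simp [B]) (by simp) fun w hw => ?_
    exact ⟨w - u, by simpa [B] using hw, by simp⟩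
  have hW : (0 : ℝ) < Fintype.card (Fin m → F) := by exact_mod_cast Fintype.card_pos
  have hp : (B.card : ℝ) / Fintype.card (Fin m → F) ≤ δ := by
    rw [div_le_iff₀ hW, hB]; exact hy
  set Δ : ℝ := (1 - σ - 2 * δ) * ((q : ℝ) - 1) / 2 with hΔ
  have hgap : 0 < 1 - σ - 2 * δ := by linarith
  have hΔ0 : 0 < Δ := by positivity
  have htail := card_deviation_le t ht4 hteven L (exists_curveDisplacement_eq t m) B Δ hΔ0
  refine ofReal_one_sub_le_toOuterMeasure_uniformOfFintype _ _ ?_ ε (htail.trans ?_)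
  · intro a ha
    simp only [Finset.mem_filter, Finset.mem_univ, true_and, not_le] at ha
    obtain ⟨P, hPd, hP0, hP⟩ := exists_polynomial_along_curve t m d f hfd u a
    have hdec : decodeAtZero (d * t) (fun s => y (u + L a s)) = P.eval 0 := by
      refine decodeAtZero_eq _ _ P hPd ?_
      have hE : (Finset.univ.filter fun s : Fˣ => y (u + L a s) ≠ P.eval (s : F)) =
          Finset.univ.filter fun s => L a s ∈ B := by
        ext s
        simp [B, hP, ← hfc, L]
      rw [hE]
      have h1 : (Fintype.card Fˣ : ℝ) * ((B.card : ℝ) / Fintype.card (Fin m → F)) ≤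
          ((q : ℝ) - 1) * δ := by rw [hcardR]; gcongr
      rw [← Nat.cast_lt (α := ℝ), Nat.cast_add, hcardR, Nat.cast_mul, Nat.cast_two]
      rw [hΔ] at ha
      nlinarith
    change (fun _ : S => decodeAtZero (d * t) fun s => y (u + L a s)) = fun s => c s.1
    funext s
    rw [hdec, hP0, hfc, Finset.mem_singleton.mp (hu s.2)]
  · gcongr
    rw [hε]
    have e : (4 * t * δ * ((q : ℝ) - 1) + 4 * (t : ℝ) ^ 2) /
        ((1 - σ - 2 * δ) ^ 2 * ((q : ℝ) - 1) ^ 2) =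
        (t * (((q : ℝ) - 1) * δ) + (t : ℝ) ^ 2) / Δ ^ 2 := by
      rw [hΔ]; field_simp; norm_num
    rw [e, hcardR]
    gcongr
end

section
/- Let q be a prime power and d, k integers with k ≥ 2 and q > d(k−1). Then there exists a (d, k, q)_q-multiplication friendly pair (π, φ) such that the F_q-linear code (π(F_{q^k}))^{*d} ⊆ F_q^q, defined as the F_q-linear span of all coordinatewise products x_1*⋯*x_d with x_1,...,x_d ∈ π(F_{q^k}), has minimum Hamming distance at least q − d(k−1). -/
open scoped BigOperators

/-- The `d`-th power code `C^{*d}`: the linear span of all coordinatewise products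
`c_1 * ⋯ * c_d` with `c_1, …, c_d ∈ C`. -/
def powerCode {F ι : Type*} [Field F] (C : Submodule F (ι → F)) (d : ℕ) :
    Submodule F (ι → F) :=
  Submodule.span F {x | ∃ c : Fin d → (ι → F), (∀ i, c i ∈ C) ∧ x = ∏ i, c i}

/-- `(π, φ)` is a `(d, k, m)_q`-multiplication friendly pair (for `K = F_{q^k}` over
`F = F_q`): `π` and `φ` are `F`-linear, `π 1` is the all-one vector, and
`φ (π α_1 * ⋯ * π α_d) = α_1 ⋯ α_d` (coordinatewise products). -/
def IsMulFriendlyPair {F K : Type*} [Field F] [Field K] [Algebra F K] (d m : ℕ)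
    (π : K →ₗ[F] (Fin m → F)) (φ : (Fin m → F) →ₗ[F] K) : Prop :=
  π 1 = 1 ∧ ∀ α : Fin d → K, φ (∏ i, π (α i)) = ∏ i, α i

open Polynomial in
/-- Every element of an algebra with a power basis of positive dimension is represented,
linearly, by a polynomial of degree less than the dimension, with `1` represented by `1`. -/
theorem PowerBasis.exists_linear_lift {F K : Type*} [Field F] [CommRing K] [Algebra F K]
    (pb : PowerBasis F K) (h : 0 < pb.dim) :
    ∃ r : K →ₗ[F] F[X], r 1 = 1 ∧ (∀ α, aeval pb.gen (r α) = α) ∧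
      ∀ α, (r α).natDegree ≤ pb.dim - 1 := by
  refine ⟨pb.basis.constr F fun i => X ^ (i : ℕ), ?_, fun α => ?_, fun α => ?_⟩
  · have h1 : (1 : K) = pb.basis ⟨0, h⟩ := by simp
    rw [h1, Module.Basis.constr_basis, pow_zero]
  · have hid : (aeval pb.gen).toLinearMap ∘ₗ (pb.basis.constr F fun i => (X : F[X]) ^ (i : ℕ))
        = LinearMap.id := pb.basis.ext fun i => by
          rw [LinearMap.comp_apply, Module.Basis.constr_basis]
          simp
    exact LinearMap.congr_fun hid α
  · rw [Module.Basis.constr_apply_fintype]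
    refine natDegree_sum_le_of_forall_le _ _ fun i _ => ?_
    refine (natDegree_smul_le _ _).trans ?_
    rw [natDegree_X_pow]
    have := i.isLt
    omega

/-- The evaluation map at a family of points. -/
noncomputable def evalPoints {F ι : Type*} [Field F] (v : ι → F) : Polynomial F →ₗ[F] (ι → F) :=
  LinearMap.pi fun i => Polynomial.leval (v i)

@[simp]
theorem evalPoints_apply {F ι : Type*} [Field F] (v : ι → F) (f : Polynomial F) (i : ι) :
    evalPoints v f i = f.eval (v i) := rfl

theorem evalPoints_prod {F ι κ : Type*} [Field F] [Fintype κ] (v : ι → F)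
    (f : κ → Polynomial F) : evalPoints v (∏ j, f j) = ∏ j, evalPoints v (f j) := by
  ext i
  simp [Polynomial.eval_prod, Finset.prod_apply]

theorem natDegree_prod_fin_le {F : Type*} [Field F] {d n : ℕ} {f : Fin d → Polynomial F}
    (hf : ∀ j, (f j).natDegree ≤ n) : (∏ j, f j).natDegree ≤ d * n :=
  (Polynomial.natDegree_prod_le _ _).trans <|
    (Finset.sum_le_sum fun j _ => hf j).trans (by simp)

/-- Powers of evaluation codes are evaluation codes of multiplied degree. -/
theorem exists_evalPoints_of_mem_powerCode {F ι : Type*} [Field F] {v : ι → F} {n d : ℕ}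
    {C : Submodule F (ι → F)} (hC : ∀ c ∈ C, ∃ f, f.natDegree ≤ n ∧ evalPoints v f = c)
    {x : ι → F} (hx : x ∈ powerCode C d) :
    ∃ f, f.natDegree ≤ d * n ∧ evalPoints v f = x := by
  induction hx using Submodule.span_induction with
  | mem x hx =>
    obtain ⟨c, hc, rfl⟩ := hx
    choose f hf hfc using fun j => hC (c j) (hc j)
    exact ⟨∏ j, f j, natDegree_prod_fin_le hf, by simp only [evalPoints_prod, hfc]⟩
  | zero => exact ⟨0, by simp, map_zero _⟩
  | add x y _ _ hx hy =>
    obtain ⟨f, hf, rfl⟩ := hx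
    obtain ⟨g, hg, rfl⟩ := hy
    exact ⟨f + g, Polynomial.natDegree_add_le_of_degree_le hf hg, map_add _ _ _⟩
  | smul a x _ hx =>
    obtain ⟨f, hf, rfl⟩ := hx
    exact ⟨a • f, (Polynomial.natDegree_smul_le _ _).trans hf, map_smul _ _ _⟩

/-- The minimum distance bound for Reed–Solomon codes. -/
theorem card_sub_natDegree_le_hammingNorm {F ι : Type*} [Field F] [DecidableEq F] [Fintype ι]
    {v : ι → F} (hv : Function.Injective v) {f : Polynomial F} (hf : f ≠ 0) :
    Fintype.card ι - f.natDegree ≤ hammingNorm (evalPoints v f) := by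
  have hz : (Finset.univ.filter fun i => evalPoints v f i = 0).card ≤ f.natDegree := by
    rw [← Finset.card_image_of_injective _ hv]
    refine Polynomial.card_le_degree_of_subset_roots fun a ha => ?_
    obtain ⟨i, hi, rfl⟩ := Finset.mem_image.mp ha
    exact (Polynomial.mem_roots hf).mpr (Finset.mem_filter.mp hi).2
  have hsum := Finset.card_filter_add_card_filter_not (s := Finset.univ)
    fun i => evalPoints v f i = 0
  rw [Finset.card_univ] at hsum
  change _ ≤ (Finset.univ.filter fun i => ¬ evalPoints v f i = 0).card
  omega

theorem stmt_4 (q k d : ℕ) (F K : Type) [Field F] [Fintype F] [DecidableEq F]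
    [Field K] [Fintype K] [Algebra F K]
    (hF : Fintype.card F = q) (hK : Fintype.card K = q ^ k)
    (hk : 2 ≤ k) (hqd : d * (k - 1) < q) :
    ∃ (π : K →ₗ[F] (Fin q → F)) (φ : (Fin q → F) →ₗ[F] K),
      IsMulFriendlyPair d q π φ ∧
      ∀ x ∈ powerCode (LinearMap.range π) d, x ≠ 0 → q - d * (k - 1) ≤ hammingNorm x := by
  let pb := Field.powerBasisOfFiniteOfSeparable F K
  have hdim : pb.dim = k := by
    rw [← pb.finrank]
    refine Nat.pow_right_injective (hF ▸ Fintype.one_lt_card : 1 < q) ?_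
    change q ^ Module.finrank F K = q ^ k
    rw [← hK, Module.card_eq_pow_finrank (K := F) (V := K), hF]
  obtain ⟨r, hr1, hr, hdeg⟩ := pb.exists_linear_lift (by omega)
  rw [hdim] at hdeg
  let v : Fin q ≃ F := (Fintype.equivFinOfCardEq hF).symm
  refine ⟨evalPoints v ∘ₗ r,
    (Polynomial.aeval pb.gen).toLinearMap ∘ₗ Lagrange.interpolate Finset.univ v,
    ⟨?_, fun α => ?_⟩, fun x hx hx0 => ?_⟩
  · ext i
    simp [hr1]
  · have hlt : (∏ j, r (α j)).degree < (Finset.univ : Finset (Fin q)).card := by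
      refine Polynomial.degree_le_natDegree.trans_lt ?_
      rw [Finset.card_fin]
      exact_mod_cast (natDegree_prod_fin_le fun j => hdeg (α j)).trans_lt hqd
    have hint := Lagrange.eq_interpolate (s := Finset.univ) v.injective.injOn hlt
    simp only [LinearMap.comp_apply, ← evalPoints_prod]
    change Polynomial.aeval pb.gen (Lagrange.interpolate Finset.univ v
      fun i => (∏ j, r (α j)).eval (v i)) = _
    rw [← hint, map_prod]
    simp only [hr]
  · obtain ⟨f, hf, rfl⟩ := exists_evalPoints_of_mem_powerCode (v := v) (n := k - 1) (by
      rintro _ ⟨α, rfl⟩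
      exact ⟨r α, hdeg α, rfl⟩) hx
    have hf0 : f ≠ 0 := by
      rintro rfl
      exact hx0 (map_zero _)
    have := card_sub_natDegree_le_hammingNorm v.injective hf0
    rw [Fintype.card_fin] at this
    omega
end

section
/- Let t ≥ 4 be an even integer and let X_1,...,X_n be t-wise independent random variables on a probability space, each taking values in {0,1}. Set X = X_1 + ⋯ + X_n and let μ = E[X] be the expectation of X. Then for every real A > 0, Pr[|X − μ| ≥ A] ≤ 8·((tμ + t²)/A²)^{t/2}. -/
open scoped BigOperators

open MeasureTheory

/-- Expansion of a product of binary sums over the subsets of the index set. -/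
lemma sum_powerset_prod_ite {ι : Type*} [DecidableEq ι] (s : Finset ι) (a b : ι → ℝ) :
    ∑ u ∈ s.powerset, ∏ i ∈ s, (if i ∈ u then a i else b i) = ∏ i ∈ s, (a i + b i) := by
  rw [Finset.prod_add]
  refine Finset.sum_congr rfl fun u hu => ?_
  rw [Finset.mem_powerset] at hu
  rw [Finset.prod_ite, Finset.filter_mem_eq_inter, Finset.inter_eq_right.mpr hu,
    Finset.filter_notMem_eq_sdiff]

/-- Product formula for the expectation of functions of `0/1` variables whose joint law on `s`
is a product. -/
lemma integral_prod_zero_one {Ω ι : Type*} [MeasurableSpace Ω] [DecidableEq ι] (P : Measure Ω)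
    [IsProbabilityMeasure P] (X : ι → Ω → ℝ) (hmeas : ∀ i, Measurable (X i))
    (h01 : ∀ i ω, X i ω = 0 ∨ X i ω = 1) (s : Finset ι)
    (hs : ∀ a : ι → ℝ, (∀ i, a i = 0 ∨ a i = 1) →
      P (⋂ i ∈ s, {ω | X i ω = a i}) = ∏ i ∈ s, P {ω | X i ω = a i}) (g : ι → ℝ → ℝ) :
    ∫ ω, ∏ i ∈ s, g i (X i ω) ∂P
      = ∏ i ∈ s, (P.real {ω | X i ω = 1} * g i 1 + P.real {ω | X i ω = 0} * g i 0) := by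
  set a : Finset ι → ι → ℝ := fun u i => if i ∈ u then 1 else 0 with ha
  have hms : ∀ u, MeasurableSet (⋂ i ∈ s, {ω | X i ω = a u i}) := fun u =>
    s.measurableSet_biInter fun i _ => hmeas i (measurableSet_singleton _)
  have hpt : ∀ ω, ∏ i ∈ s, g i (X i ω) = ∑ u ∈ s.powerset,
      (∏ i ∈ s, g i (a u i)) * (⋂ i ∈ s, {ω | X i ω = a u i}).indicator 1 ω := by
    intro ω
    have hX : ∀ i ∈ s, X i ω = a (s.filter fun i => X i ω = 1) i := by
      intro i hi
      rcases h01 i ω with h | h <;> simp [ha, hi, h]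
    rw [Finset.sum_eq_single (s.filter fun i => X i ω = 1)]
    · rw [Set.indicator_of_mem (by simpa using hX), Pi.one_apply, mul_one]
      exact Finset.prod_congr rfl fun i hi => by rw [← hX i hi]
    · intro u hu hne
      rw [Set.indicator_of_notMem, mul_zero]
      intro hmem
      apply hne
      simp only [Set.mem_iInter, Set.mem_ofPred_eq] at hmem
      ext i
      rw [Finset.mem_filter]
      constructor
      · intro hi
        have his := Finset.mem_powerset.mp hu hi
        exact ⟨his, by rw [hmem i his]; simp [ha, hi]⟩
      · rintro ⟨his, hi⟩
        by_contra hiu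
        have := hmem i his
        simp [ha, hiu, hi] at this
    · intro h
      exact absurd (Finset.mem_powerset.mpr (Finset.filter_subset _ _)) h
  simp_rw [hpt]
  have hint : ∀ u, Integrable ((⋂ i ∈ s, {ω | X i ω = a u i}).indicator (1 : Ω → ℝ)) P :=
    fun u => (integrable_const (1 : ℝ)).indicator (hms u)
  rw [integral_finsetSum _ fun u _ => (hint u).const_mul _]
  rw [← sum_powerset_prod_ite]
  refine Finset.sum_congr rfl fun u _ => ?_
  rw [integral_const_mul, integral_indicator_one (hms u), measureReal_def,
    hs (a u) (fun i => by by_cases h : i ∈ u <;> simp [ha, h]), ENNReal.toReal_prod,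
    ← Finset.prod_mul_distrib]
  refine Finset.prod_congr rfl fun i _ => ?_
  by_cases h : i ∈ u <;> simp [ha, h, measureReal_def, mul_comm]

lemma factorial_mul_exp_le (t : ℕ) (ht : 2 ≤ t) :
    (t.factorial : ℝ) * Real.exp (3 / 4 * t) ≤ 4 * (t : ℝ) ^ t := by
  induction t, ht using Nat.le_induction with
  | base =>
    have h : Real.exp (3 / 4 * (2 : ℕ)) ≤ 8 := by
      have : Real.exp (3 / 4 * (2 : ℕ)) ≤ Real.exp 1 * Real.exp 1 := by
        rw [← Real.exp_add]; exact Real.exp_le_exp.mpr (by norm_num)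
      nlinarith [Real.exp_one_lt_d9, Real.exp_pos 1]
    norm_num [Nat.factorial] at h ⊢
    linarith
  | succ k hk ih =>
    have hk' : (2 : ℝ) ≤ k := by exact_mod_cast hk
    have hk0 : (0 : ℝ) < k := by linarith
    have hlog : 3 / 4 ≤ k * Real.log (1 + 1 / k) := by
      have h := Real.le_log_one_add_of_nonneg (x := 1 / (k : ℝ)) (by positivity)
      have h2 : 3 / 4 ≤ (k : ℝ) * (2 * (1 / k) / (1 / k + 2)) := by
        have : (k : ℝ) * (2 * (1 / k) / (1 / k + 2)) = 2 * k / (1 + 2 * k) := by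
          field_simp
        rw [this, le_div_iff₀ (by positivity)]
        linarith
      exact h2.trans (mul_le_mul_of_nonneg_left h hk0.le)
    have hexp : Real.exp (3 / 4) * (k : ℝ) ^ k ≤ ((k : ℝ) + 1) ^ k := by
      have h1 : Real.exp (3 / 4) ≤ (1 + 1 / (k : ℝ)) ^ k := by
        rw [← Real.exp_log (show (0 : ℝ) < 1 + 1 / k by positivity), ← Real.exp_nat_mul]
        exact Real.exp_le_exp.mpr hlog
      calc Real.exp (3 / 4) * (k : ℝ) ^ k ≤ (1 + 1 / (k : ℝ)) ^ k * (k : ℝ) ^ k := by gcongr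
        _ = ((k : ℝ) + 1) ^ k := by rw [← mul_pow]; congr 1; field_simp
    have hsplit : Real.exp (3 / 4 * ((k + 1 : ℕ) : ℝ))
        = Real.exp (3 / 4 * k) * Real.exp (3 / 4) := by
      rw [← Real.exp_add]; congr 1; push_cast; ring
    rw [hsplit, Nat.factorial_succ]
    push_cast
    calc ((k : ℝ) + 1) * k.factorial * (Real.exp (3 / 4 * k) * Real.exp (3 / 4))
        = (k.factorial * Real.exp (3 / 4 * k)) * (Real.exp (3 / 4) * (k + 1)) := by ring
      _ ≤ (4 * (k : ℝ) ^ k) * (Real.exp (3 / 4) * (k + 1)) := by gcongr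
      _ = 4 * (Real.exp (3 / 4) * (k : ℝ) ^ k) * (k + 1) := by ring
      _ ≤ 4 * ((k : ℝ) + 1) ^ k * (k + 1) := by gcongr
      _ = 4 * ((k : ℝ) + 1) ^ (k + 1) := by ring

/-- Moment generating function bound for a centred Bernoulli variable. -/
lemma centred_bernoulli_mgf_le {p l : ℝ} (hp : 0 ≤ p) (hl : |l| ≤ 1) :
    p * Real.exp (l * (1 - p)) + (1 - p) * Real.exp (l * (0 - p))
      ≤ Real.exp (3 / 4 * l ^ 2 * p) := by
  have h := Real.exp_bound hl (n := 2) (by norm_num)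
  norm_num [Finset.sum_range_succ, Nat.factorial] at h
  have h1 := (abs_le.mp h).2
  have h2 : p * Real.exp (l * (1 - p)) + (1 - p) * Real.exp (l * (0 - p))
      = Real.exp (-(l * p)) * (p * (Real.exp l - 1) + 1) := by
    have e1 : Real.exp (l * (1 - p)) = Real.exp (-(l * p)) * Real.exp l := by
      rw [← Real.exp_add]; ring_nf
    have e2 : Real.exp (l * (0 - p)) = Real.exp (-(l * p)) := by ring_nf
    rw [e1, e2]; ring
  rw [h2]
  calc Real.exp (-(l * p)) * (p * (Real.exp l - 1) + 1)
      ≤ Real.exp (-(l * p)) * Real.exp (p * (Real.exp l - 1)) := by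
        gcongr; exact Real.add_one_le_exp _
    _ = Real.exp (p * (Real.exp l - 1) - l * p) := by rw [← Real.exp_add]; ring_nf
    _ ≤ Real.exp (3 / 4 * l ^ 2 * p) := Real.exp_le_exp.mpr (by nlinarith)

/-- The multinomial expression of the `t`-th central moment of a sum of independent Bernoulli
variables, bounded via the exponential moment at a parameter `l ∈ (0, 1]`. -/
lemma bernoulli_sum_moment_le {ι : Type*} [DecidableEq ι] [Fintype ι] (p : ι → ℝ)
    (hp0 : ∀ i, 0 ≤ p i) (hp1 : ∀ i, p i ≤ 1) (t : ℕ) (ht : Even t) {l : ℝ} (hl0 : 0 < l)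
    (hl1 : l ≤ 1) :
    ∑ k ∈ Finset.univ.piAntidiag t, (Nat.multinomial Finset.univ k : ℝ) *
        ∏ i, (p i * (1 - p i) ^ k i + (1 - p i) * (0 - p i) ^ k i)
      ≤ 2 * t.factorial / l ^ t * Real.exp (3 / 4 * l ^ 2 * ∑ i, p i) := by
  set w : Finset ι → ℝ := fun u => ∏ i, if i ∈ u then p i else 1 - p i with hw
  set y : Finset ι → ι → ℝ := fun u i => (if i ∈ u then 1 else 0) - p i with hy
  have hw0 : ∀ u, 0 ≤ w u := fun u => Finset.prod_nonneg fun i _ => by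
    split_ifs
    · exact hp0 i
    · linarith [hp1 i]
  have hfac : ∀ g : ι → ℝ → ℝ, ∑ u, w u * ∏ i, g i (y u i)
      = ∏ i, (p i * g i (1 - p i) + (1 - p i) * g i (0 - p i)) := by
    intro g
    rw [← sum_powerset_prod_ite, Finset.powerset_univ]
    refine Finset.sum_congr rfl fun u _ => ?_
    rw [hw, ← Finset.prod_mul_distrib]
    refine Finset.prod_congr rfl fun i _ => ?_
    by_cases h : i ∈ u <;> simp [hy, h]
  have hmom : ∑ k ∈ Finset.univ.piAntidiag t, (Nat.multinomial Finset.univ k : ℝ) *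
        ∏ i, (p i * (1 - p i) ^ k i + (1 - p i) * (0 - p i) ^ k i)
      = ∑ u, w u * (∑ i, y u i) ^ t := by
    simp_rw [Finset.sum_pow_eq_sum_piAntidiag, Finset.mul_sum]
    rw [Finset.sum_comm]
    refine Finset.sum_congr rfl fun k _ => ?_
    rw [← hfac fun i x => x ^ k i, Finset.mul_sum]
    exact Finset.sum_congr rfl fun u _ => by ring
  have hmgf : ∀ c : ℝ, |c| ≤ 1 → ∑ u, w u * Real.exp (c * ∑ i, y u i)
      ≤ Real.exp (3 / 4 * c ^ 2 * ∑ i, p i) := by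
    intro c hc
    simp_rw [Finset.mul_sum, Real.exp_sum]
    rw [hfac fun i x => Real.exp (c * x)]
    refine Finset.prod_le_prod (fun i _ => ?_) fun i _ => centred_bernoulli_mgf_le (hp0 i) hc
    have := hp0 i
    have : 0 ≤ 1 - p i := by linarith [hp1 i]
    positivity
  have hpow : ∀ x : ℝ, x ^ t
      ≤ t.factorial / l ^ t * (Real.exp (l * x) + Real.exp (-l * x)) := by
    intro x
    have h1 := Real.pow_div_factorial_le_exp |l * x| (abs_nonneg _) t
    have h2 : Real.exp |l * x| ≤ Real.exp (l * x) + Real.exp (-l * x) := by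
      rcases abs_cases (l * x) with h | h
      · rw [h.1]; linarith [Real.exp_pos (-l * x)]
      · rw [h.1, neg_mul]; linarith [Real.exp_pos (l * x)]
    rw [ht.pow_abs, div_le_iff₀ (by positivity), mul_pow] at h1
    rw [div_mul_eq_mul_div, le_div_iff₀ (by positivity)]
    nlinarith [mul_le_mul_of_nonneg_right h2 (Nat.cast_nonneg (α := ℝ) t.factorial)]
  rw [hmom]
  calc ∑ u, w u * (∑ i, y u i) ^ t
      ≤ ∑ u, w u * (t.factorial / l ^ t *
          (Real.exp (l * ∑ i, y u i) + Real.exp (-l * ∑ i, y u i))) :=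
        Finset.sum_le_sum fun u _ => mul_le_mul_of_nonneg_left (hpow _) (hw0 u)
    _ = t.factorial / l ^ t * (∑ u, w u * Real.exp (l * ∑ i, y u i)
          + ∑ u, w u * Real.exp (-l * ∑ i, y u i)) := by
        rw [← Finset.sum_add_distrib, Finset.mul_sum]
        exact Finset.sum_congr rfl fun u _ => by ring
    _ ≤ t.factorial / l ^ t * (Real.exp (3 / 4 * l ^ 2 * ∑ i, p i)
          + Real.exp (3 / 4 * (-l) ^ 2 * ∑ i, p i)) := by
        gcongr
        · exact hmgf l (abs_le.mpr ⟨by linarith, hl1⟩)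
        · exact hmgf (-l) (abs_le.mpr ⟨by linarith, by linarith⟩)
    _ = 2 * t.factorial / l ^ t * Real.exp (3 / 4 * l ^ 2 * ∑ i, p i) := by
        rw [neg_sq]; ring

/-- The choice `l ^ 2 = t / (μ + t)` in the exponential moment bound. -/
lemma exponential_moment_bound_optimized (t : ℕ) (ht : 2 ≤ t) (hte : Even t) {μ : ℝ}
    (hμ : 0 ≤ μ) :
    ∃ l : ℝ, 0 < l ∧ l ≤ 1 ∧ 2 * t.factorial / l ^ t * Real.exp (3 / 4 * l ^ 2 * μ)
      ≤ 8 * (t * μ + (t : ℝ) ^ 2) ^ (t / 2) := by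
  have ht0 : (0 : ℝ) < t := by exact_mod_cast (by omega : 0 < t)
  have hpos : 0 < (t : ℝ) / (μ + t) := by positivity
  have hle : (t : ℝ) / (μ + t) ≤ 1 := by
    rw [div_le_one (by positivity)]; linarith
  have hsq : √((t : ℝ) / (μ + t)) ^ 2 = t / (μ + t) := Real.sq_sqrt hpos.le
  refine ⟨√((t : ℝ) / (μ + t)), Real.sqrt_pos.mpr hpos, Real.sqrt_le_one.mpr hle, ?_⟩
  obtain ⟨m, hm⟩ := hte
  have hm2 : t = 2 * m := by omega
  have hlt : √((t : ℝ) / (μ + t)) ^ t = ((t : ℝ) / (μ + t)) ^ m := by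
    conv_lhs => rw [hm2, pow_mul, ← hm2, hsq]
  have hmt : t / 2 = m := by omega
  rw [hlt, hsq, hmt]
  have hexp : Real.exp (3 / 4 * ((t : ℝ) / (μ + t)) * μ) ≤ Real.exp (3 / 4 * t) := by
    apply Real.exp_le_exp.mpr
    have : (t : ℝ) / (μ + t) * μ ≤ t := by
      rw [div_mul_eq_mul_div, div_le_iff₀ (by positivity)]
      nlinarith
    linarith
  have hfin : (t : ℝ) ^ t / ((t : ℝ) / (μ + t)) ^ m = (t * μ + (t : ℝ) ^ 2) ^ m := by
    have : (t : ℝ) ^ t = ((t : ℝ) ^ 2) ^ m := by rw [← pow_mul, ← hm2]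
    rw [this, ← div_pow]
    congr 1
    field_simp
  calc 2 * t.factorial / ((t : ℝ) / (μ + t)) ^ m * Real.exp (3 / 4 * (t / (μ + t)) * μ)
      ≤ 2 * t.factorial / ((t : ℝ) / (μ + t)) ^ m * Real.exp (3 / 4 * t) := by gcongr
    _ = 2 * (t.factorial * Real.exp (3 / 4 * t)) / ((t : ℝ) / (μ + t)) ^ m := by ring
    _ ≤ 2 * (4 * (t : ℝ) ^ t) / ((t : ℝ) / (μ + t)) ^ m := by
        gcongr ?_ / _
        exact mul_le_mul_of_nonneg_left (factorial_mul_exp_le t ht) zero_le_two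
    _ = 8 * ((t : ℝ) ^ t / ((t : ℝ) / (μ + t)) ^ m) := by ring
    _ = _ := by rw [hfin]

theorem stmt_8 {Ω : Type*} [MeasurableSpace Ω] (P : MeasureTheory.Measure Ω)
    [MeasureTheory.IsProbabilityMeasure P]
    (t n : ℕ) (ht4 : 4 ≤ t) (hteven : Even t)
    (X : Fin n → Ω → ℝ) (hmeas : ∀ i, Measurable (X i))
    (h01 : ∀ i ω, X i ω = 0 ∨ X i ω = 1)
    (htwise : ∀ s : Finset (Fin n), s.card = t → ∀ a : Fin n → ℝ,
      (∀ i, a i = 0 ∨ a i = 1) →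
      P (⋂ i ∈ s, {ω | X i ω = a i}) = ∏ i ∈ s, P {ω | X i ω = a i})
    (μ : ℝ) (hμ : μ = ∫ ω, (∑ i, X i ω) ∂P)
    (A : ℝ) (hA : 0 < A) :
    P {ω | A ≤ |(∑ i, X i ω) - μ|}
      ≤ ENNReal.ofReal (8 * ((t * μ + (t : ℝ) ^ 2) / A ^ 2) ^ (t / 2)) := by
  set p : Fin n → ℝ := fun i => P.real {ω | X i ω = 1} with hp
  have hms1 : ∀ i, MeasurableSet {ω | X i ω = 1} := fun i =>
    hmeas i (measurableSet_singleton 1)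
  have hp0 : ∀ i, 0 ≤ p i := fun i => measureReal_nonneg
  have hp1 : ∀ i, p i ≤ 1 := fun i => measureReal_le_one
  have hq : ∀ i, P.real {ω | X i ω = 0} = 1 - p i := by
    intro i
    rw [hp, ← probReal_compl_eq_one_sub (hms1 i)]
    congr 1
    ext ω
    rcases h01 i ω with h | h <;> simp [h]
  have hX0 : ∀ i ω, 0 ≤ X i ω := fun i ω => by rcases h01 i ω with h | h <;> simp [h]
  have hX1 : ∀ i ω, X i ω ≤ 1 := fun i ω => by rcases h01 i ω with h | h <;> simp [h]
  have hbdd : ∀ f : Ω → ℝ, Measurable f → ∀ C : ℝ, (∀ ω, |f ω| ≤ C) → Integrable f P :=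
    fun f hf C hC => Integrable.of_bound hf.aestronglyMeasurable C (Filter.Eventually.of_forall hC)
  have hμp : μ = ∑ i, p i := by
    rw [hμ, integral_finsetSum _ fun i _ => hbdd _ (hmeas i) 1 fun ω =>
      abs_le.mpr ⟨by linarith [hX0 i ω], hX1 i ω⟩]
    refine Finset.sum_congr rfl fun i _ => ?_
    refine Eq.trans ?_ (integral_indicator_one (hms1 i))
    congr 1
    ext ω
    rcases h01 i ω with h | h <;> simp [Set.indicator, h]
  have hμ0 : 0 ≤ μ := hμp ▸ Finset.sum_nonneg fun i _ => hp0 i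
  have hμn : μ ≤ n := by
    rw [hμp]
    simpa using Finset.sum_le_sum fun i (_ : i ∈ Finset.univ) => hp1 i
  have hdev : ∀ ω, |(∑ i, X i ω) - μ| ≤ n := by
    intro ω
    have h0 : 0 ≤ ∑ i, X i ω := Finset.sum_nonneg fun i _ => hX0 i ω
    have h1 : ∑ i, X i ω ≤ n := by
      simpa using Finset.sum_le_sum fun i (_ : i ∈ Finset.univ) => hX1 i ω
    exact abs_le.mpr ⟨by linarith, by linarith⟩
  have ht0 : (0 : ℝ) < t := by exact_mod_cast (by omega : 0 < t)
  rcases lt_or_ge n t with hnt | hnt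
  · -- The deviation never exceeds `n < t`, so the bound is at least `1` or the event is empty.
    have hnt' : (n : ℝ) < t := by exact_mod_cast hnt
    rcases le_or_gt A t with hAt | hAt
    · refine prob_le_one.trans ?_
      rw [← ENNReal.ofReal_one]
      apply ENNReal.ofReal_le_ofReal
      have : 1 ≤ (t * μ + (t : ℝ) ^ 2) / A ^ 2 := by
        rw [le_div_iff₀ (by positivity)]
        nlinarith [mul_nonneg ht0.le hμ0]
      linarith [one_le_pow₀ this (n := t / 2)]
    · have : {ω | A ≤ |(∑ i, X i ω) - μ|} = ∅ := by
        ext ω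
        simp only [Set.mem_ofPred_eq, Set.mem_empty_iff_false, iff_false, not_le]
        linarith [hdev ω]
      rw [this, measure_empty]
      exact zero_le
  have hsum : ∀ ω, (∑ i, X i ω) - μ = ∑ i, (X i ω - p i) := fun ω => by
    rw [hμp, Finset.sum_sub_distrib]
  have hmom : ∫ ω, ((∑ i, X i ω) - μ) ^ t ∂P
      = ∑ k ∈ Finset.univ.piAntidiag t, (Nat.multinomial Finset.univ k : ℝ) *
        ∏ i, (p i * (1 - p i) ^ k i + (1 - p i) * (0 - p i) ^ k i) := by
    simp_rw [hsum, Finset.sum_pow_eq_sum_piAntidiag]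
    rw [integral_finsetSum]
    · refine Finset.sum_congr rfl fun k hk => ?_
      rw [integral_const_mul]
      congr 1
      have hksum : ∑ i, k i = t := (Finset.mem_piAntidiag.mp hk).1
      have hcard : (Finset.univ.filter fun i => k i ≠ 0).card ≤ t := by
        rw [← hksum, Finset.card_eq_sum_ones, Finset.sum_filter]
        exact Finset.sum_le_sum fun i _ => by split_ifs <;> omega
      obtain ⟨s, hs, hst⟩ := Finset.exists_superset_card_eq hcard (by simpa using hnt)
      have hk0 : ∀ i, i ∉ s → k i = 0 := fun i hi => by
        by_contra h
        exact hi (hs (by simpa using h))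
      rw [← Finset.prod_subset (Finset.subset_univ s) fun i _ hi => by simp [hk0 i hi]]
      have hprod := integral_prod_zero_one P X hmeas h01 s (htwise s hst)
        fun i x => (x - p i) ^ k i
      simp_rw [hq] at hprod
      refine Eq.trans ?_ hprod
      congr 1
      ext ω
      exact (Finset.prod_subset (Finset.subset_univ s) fun i _ hi => by simp [hk0 i hi]).symm
    · intro k _
      refine (hbdd _ (Finset.measurable_prod _ fun i _ => ((hmeas i).sub_const _).pow_const _) 1
        fun ω => ?_).const_mul _
      rw [Finset.abs_prod]
      refine Finset.prod_le_one (fun i _ => abs_nonneg _) fun i _ => ?_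
      rw [abs_pow]
      exact pow_le_one₀ (abs_nonneg _) (abs_le.mpr
        ⟨by linarith [hX0 i ω, hp1 i], by linarith [hX1 i ω, hp0 i]⟩)
  obtain ⟨l, hl0, hl1, hl⟩ := exponential_moment_bound_optimized t (by omega) hteven hμ0
  have hbound : ∫ ω, ((∑ i, X i ω) - μ) ^ t ∂P ≤ 8 * (t * μ + (t : ℝ) ^ 2) ^ (t / 2) := by
    rw [hmom]
    refine (bernoulli_sum_moment_le p hp0 hp1 t hteven hl0 hl1).trans ?_
    rwa [← hμp]
  have hmarkov := mul_meas_ge_le_integral_of_nonneg (μ := P)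
    (f := fun ω => ((∑ i, X i ω) - μ) ^ t)
    (Filter.Eventually.of_forall fun ω => hteven.pow_nonneg _)
    (hbdd _ (((Finset.measurable_sum _ fun i _ => hmeas i).sub_const _).pow_const _)
      ((n : ℝ) ^ t) fun ω => by
        rw [abs_pow]; exact pow_le_pow_left₀ (abs_nonneg _) (hdev ω) t) (A ^ t)
  have hset : {ω | A ^ t ≤ ((∑ i, X i ω) - μ) ^ t} = {ω | A ≤ |(∑ i, X i ω) - μ|} := by
    ext ω
    rw [Set.mem_ofPred_eq, Set.mem_ofPred_eq, ← hteven.pow_abs (_ - μ),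
      pow_le_pow_iff_left₀ hA.le (abs_nonneg _) (by omega)]
  rw [hset] at hmarkov
  rw [← ofReal_measureReal]
  apply ENNReal.ofReal_le_ofReal
  have hAt : (A ^ 2) ^ (t / 2) = A ^ t := by
    rw [← pow_mul, Nat.mul_div_cancel' hteven.two_dvd]
  rw [div_pow, hAt, ← mul_div_assoc, le_div_iff₀ (by positivity), mul_comm]
  exact hmarkov.trans hbound
end

section
/- Let (C, ψ) be an (n, t, d, r; F_q^k/F_q)-codex and let ψ̄ : C^{*d} → F_q^k be any F_q-linear extension of ψ satisfying the multiplicative relation ψ̄(c_1*⋯*c_d) = ψ(c_1)*⋯*ψ(c_d) for all c_1,...,c_d ∈ C. Let m be a positive integer, f ∈ F_q[x_1,...,x_m] a polynomial of total degree at most d, and c_1,...,c_m ∈ C. For j ∈ {1,...,n} set v_j = (c_{1,j},...,c_{m,j}) ∈ F_q^m, and for i ∈ {1,...,k} set w_i = (ψ(c_1)_i,...,ψ(c_m)_i) ∈ F_q^m. Let ã : F_q^m → F_q be any function such that the number of indices j with ã(v_j) ≠ f(v_j) is at most (n − r)/2. Then every z ∈ C^{*d} for which the number of indices j with z_j ≠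 ã(v_j) is at most (n − r)/2 satisfies ψ̄(z) = (f(w_1),...,f(w_k)). -/
open scoped BigOperators

/-- `(C, ψ)` is an `(n, t, d, r; F^k/F)`-codex. -/
def IsCodex {F : Type*} [Field F] [DecidableEq F] (n t d r k : ℕ)
    (C : Submodule F (Fin n → F)) (ψ : C →ₗ[F] (Fin k → F)) : Prop :=
  Function.Surjective ψ ∧
  (∃ h1 : (1 : Fin n → F) ∈ C, ψ ⟨1, h1⟩ = 1) ∧
  (∀ A : Finset (Fin n), A.card = t →
    Function.Surjective fun c : C =>
      ((ψ c, fun a : ↥A => (c : Fin n → F) a) : (Fin k → F) × (↥A → F))) ∧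
  (∀ z ∈ powerCode C d, z ≠ 0 → n - r + 1 ≤ hammingNorm z) ∧
  (∃ ψbar : ↥(powerCode C d) →ₗ[F] (Fin k → F),
    (∀ (x : C) (hx : (x : Fin n → F) ∈ powerCode C d), ψbar ⟨x, hx⟩ = ψ x) ∧
    (∀ (c : Fin d → C) (h : (∏ i, (c i : Fin n → F)) ∈ powerCode C d),
      ψbar ⟨∏ i, (c i : Fin n → F), h⟩ = ∏ i, ψ (c i)))

/-- A list of at most `d` elements of `C` can be padded with the all-one vector to a family of
exactly `d` elements with the same product, before and after applying `ψ`. -/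
theorem exists_family_prod_eq_list_prod {F ι κ : Type*} [Field F] (C : Submodule F (ι → F))
    (ψ : C →ₗ[F] (κ → F)) (h1 : (1 : ι → F) ∈ C) (hψ1 : ψ ⟨1, h1⟩ = 1) (d : ℕ) (L : List C)
    (hL : L.length ≤ d) :
    ∃ e : Fin d → C, ∏ i, (e i : ι → F) = (L.map fun x : C => (x : ι → F)).prod ∧
      ∏ i, ψ (e i) = (L.map ψ).prod := by
  induction d generalizing L with
  | zero =>
    obtain rfl : L = [] := List.length_eq_zero_iff.mp (Nat.le_zero.mp hL)
    exact ⟨Fin.elim0, by simp, by simp⟩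
  | succ d ih =>
    cases L with
    | nil =>
      refine ⟨fun _ => ⟨1, h1⟩, by simp, by simp [hψ1]⟩
    | cons a L =>
      obtain ⟨e, he, he'⟩ := ih L (by simpa using hL)
      exact ⟨Fin.cons a e, by simp [Fin.prod_univ_succ, he], by simp [Fin.prod_univ_succ, he']⟩

/-- The product of `g` over the multiset of a finitely supported exponent vector. -/
theorem prod_map_toList_toMultiset {σ M : Type*} [CommMonoid M] (s : σ →₀ ℕ) (g : σ → M) :
    (s.toMultiset.toList.map g).prod = s.prod (fun l a => g l ^ a) := by
  rw [← Multiset.prod_coe, ← Multiset.map_coe, Multiset.coe_toList, Finsupp.toMultiset_map,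
    Finsupp.prod_toMultiset, Finsupp.prod_mapDomain_index (by simp) (by simp [pow_add])]

/-- A monomial of degree at most `d` in elements of `C` is a product of exactly `d` elements
of `C`, compatibly with `ψ`. -/
theorem exists_family_prod_eq_monomial {F ι κ σ : Type*} [Field F] (C : Submodule F (ι → F))
    (ψ : C →ₗ[F] (κ → F)) (h1 : (1 : ι → F) ∈ C) (hψ1 : ψ ⟨1, h1⟩ = 1) (d : ℕ)
    (c : σ → C) (s : σ →₀ ℕ) (hs : (s.sum fun _ a => a) ≤ d) :
    ∃ e : Fin d → C, ∏ i, (e i : ι → F) = s.prod (fun l a => (c l : ι → F) ^ a) ∧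
      ∏ i, ψ (e i) = s.prod (fun l a => ψ (c l) ^ a) := by
  obtain ⟨e, he, he'⟩ := exists_family_prod_eq_list_prod C ψ h1 hψ1 d
    (s.toMultiset.toList.map c) (by simpa [Finsupp.card_toMultiset, Finsupp.sum] using hs)
  refine ⟨e, ?_, ?_⟩
  · rw [he, List.map_map, ← prod_map_toList_toMultiset]
    rfl
  · rw [he', List.map_map, ← prod_map_toList_toMultiset]
    rfl

/-- The vector of values of a polynomial of degree at most `d` at codewords lies in the `d`-th
power code, and a multiplicative extension of `ψ` commutes with the evaluation. -/
theorem exists_powerCode_eval {F ι κ σ : Type*} [Field F] (C : Submodule F (ι → F))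
    (ψ : C →ₗ[F] (κ → F)) (h1 : (1 : ι → F) ∈ C) (hψ1 : ψ ⟨1, h1⟩ = 1) {d : ℕ}
    (ψbar : ↥(powerCode C d) →ₗ[F] (κ → F))
    (hmul : ∀ (c : Fin d → C) (h : (∏ i, (c i : ι → F)) ∈ powerCode C d),
      ψbar ⟨∏ i, (c i : ι → F), h⟩ = ∏ i, ψ (c i))
    (f : MvPolynomial σ F) (hf : f.totalDegree ≤ d) (c : σ → C) :
    ∃ z : ↥(powerCode C d),
      (z : ι → F) = (fun j => MvPolynomial.eval (fun l => (c l : ι → F) j) f) ∧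
      ψbar z = fun i => MvPolynomial.eval (fun l => ψ (c l) i) f := by
  have hmon : ∀ s ∈ f.support, ∃ z : ↥(powerCode C d),
      (z : ι → F) = s.prod (fun l a => (c l : ι → F) ^ a) ∧
      ψbar z = s.prod (fun l a => ψ (c l) ^ a) := by
    intro s hs
    obtain ⟨e, he, he'⟩ := exists_family_prod_eq_monomial C ψ h1 hψ1 d c s
      ((MvPolynomial.le_totalDegree hs).trans hf)
    have hmem : ∏ i, (e i : ι → F) ∈ powerCode C d :=
      Submodule.subset_span ⟨fun i => e i, fun i => (e i).2, rfl⟩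
    exact ⟨⟨_, hmem⟩, he, (hmul e hmem).trans he'⟩
  choose! y hy hy' using hmon
  refine ⟨∑ s ∈ f.support, f.coeff s • y s, ?_, ?_⟩
  · ext j
    rw [MvPolynomial.eval_eq, Submodule.coe_sum, Finset.sum_apply]
    refine Finset.sum_congr rfl fun s hs => ?_
    simp [hy s hs, Finsupp.prod]
  · ext i
    rw [MvPolynomial.eval_eq, map_sum, Finset.sum_apply]
    refine Finset.sum_congr rfl fun s hs => ?_
    simp [hy' s hs, Finsupp.prod]

theorem stmt_11 {F : Type*} [Field F] [Fintype F] [DecidableEq F]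
    {n t d r k : ℕ} (hd : 2 ≤ d) (ht : 1 ≤ t) (htr : t < r) (hrn : r ≤ n)
    (C : Submodule F (Fin n → F)) (ψ : C →ₗ[F] (Fin k → F))
    (hcodex : IsCodex n t d r k C ψ)
    (ψbar : ↥(powerCode C d) →ₗ[F] (Fin k → F))
    (hext : ∀ (x : C) (hx : (x : Fin n → F) ∈ powerCode C d), ψbar ⟨x, hx⟩ = ψ x)
    (hmul : ∀ (c : Fin d → C) (h : (∏ i, (c i : Fin n → F)) ∈ powerCode C d),
      ψbar ⟨∏ i, (c i : Fin n → F), h⟩ = ∏ i, ψ (c i))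
    (m : ℕ) (hm : 0 < m) (f : MvPolynomial (Fin m) F) (hf : f.totalDegree ≤ d)
    (c : Fin m → C)
    (atilde : (Fin m → F) → F)
    (hatilde : (hammingDist (fun j => atilde (fun i => (c i : Fin n → F) j))
        (fun j => MvPolynomial.eval (fun i => (c i : Fin n → F) j) f) : ℝ)
        ≤ ((n : ℝ) - r) / 2)
    (z : ↥(powerCode C d))
    (hz : (hammingDist (fun j => (z : Fin n → F) j)
        (fun j => atilde (fun i => (c i : Fin n → F) j)) : ℝ) ≤ ((n : ℝ) - r) / 2) :
    ψbar z = fun i => MvPolynomial.eval (fun l => ψ (c l) i) f := by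
  obtain ⟨-, ⟨h1, hψ1⟩, -, hdist, -⟩ := hcodex
  obtain ⟨y, hy, hy'⟩ := exists_powerCode_eval C ψ h1 hψ1 ψbar hmul f hf c
  suffices hzy : z = y by rw [hzy, hy']
  by_contra hne
  have hlow := hdist (-z + y : Fin n → F) (add_mem (neg_mem z.2) y.2)
    (fun h => hne (Subtype.ext (neg_add_eq_zero.mp h)))
  rw [← hammingDist_eq_hammingNorm] at hlow
  have htri := hammingDist_triangle (z : Fin n → F)
    (fun j => atilde (fun i => (c i : Fin n → F) j)) (y : Fin n → F)
  rw [← hy] at hatilde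
  have hsum : (hammingDist (z : Fin n → F) (y : Fin n → F) : ℝ) ≤ (n : ℝ) - r := by
    have : (hammingDist (z : Fin n → F) (y : Fin n → F) : ℝ) ≤ _ := Nat.cast_le.mpr htri
    push_cast at this
    linarith
  rw [← Nat.cast_sub hrn, Nat.cast_le] at hsum
  omega
end

section
/- Let F_q be a finite field, C ⊆ F_q^n an F_q-linear code, and ψ : C → F_q^k a surjective F_q-linear map such that for every A ⊆ {1,...,n} with |A| = t, the map C → F_q^k × F_q^t sending c to (ψ(c), c|_A) is surjective. Let m be a positive integer and fix w_1,...,w_k ∈ F_q^m. For i = 1,...,m let c_i be chosen uniformly at random from the (nonempty) set {c ∈ C : ψ(c) = (w_{1,i},...,w_{k,i})}, with c_1,...,c_m mutually independent, and for j ∈ {1,...,n} set v_j = (c_{1,j},...,c_{m,j}) ∈ F_q^m. Then for every A ⊆ {1,...,n} with |A| = t, the random tuple (v_j)_{j∈A} is uniformly distributed on (F_q^m)^t; in particular, the random vectors v_1,...,v_n are t-wise independent and each uniformly distributed on F_q^m. -/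
open scoped BigOperators

theorem stmt_12 {F : Type*} [Field F] [Fintype F] {n k t m : ℕ}
    (C : Submodule F (Fin n → F)) (ψ : C →ₗ[F] (Fin k → F))
    (hsurj : Function.Surjective ψ)
    (hpriv : ∀ A : Finset (Fin n), A.card = t →
      Function.Surjective fun c : C =>
        ((ψ c, fun a : ↥A => (c : Fin n → F) a) : (Fin k → F) × (↥A → F)))
    (hm : 0 < m) (w : Fin k → Fin m → F)
    (A : Finset (Fin n)) (hA : A.card = t) (u : ↥A → Fin m → F) :
    Nat.card {c : Fin m → C // (∀ i, ψ (c i) = fun l => w l i) ∧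
        ∀ (j : ↥A) (i : Fin m), (c i : Fin n → F) j = u j i}
      * (Fintype.card F) ^ (m * t)
    = Nat.card {c : Fin m → C // ∀ i, ψ (c i) = fun l => w l i} := by
  have hsection : ∀ y : ↥A → F, ∃ c : C, ψ c = 0 ∧ ∀ j : ↥A, (c : Fin n → F) j = y j := by
    intro y
    obtain ⟨c, hc⟩ := hpriv A hA (0, y)
    obtain ⟨h₁, h₂⟩ := Prod.ext_iff.mp hc
    exact ⟨c, h₁, fun j => congrFun h₂ j⟩
  choose s hs₀ hs using hsection
  let e : {c : Fin m → C // ∀ i, ψ (c i) = fun l => w l i} ≃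
      {c : Fin m → C // (∀ i, ψ (c i) = fun l => w l i) ∧
        ∀ (j : ↥A) (i : Fin m), (c i : Fin n → F) j = u j i} × (Fin m → ↥A → F) :=
    { toFun := fun c =>
        (⟨fun i => c.1 i - s fun j => (c.1 i : Fin n → F) j - u j i, by
          refine ⟨fun i => ?_, fun j i => ?_⟩
          · rw [map_sub, hs₀, sub_zero, c.2 i]
          · simp [hs]⟩, fun i j => (c.1 i : Fin n → F) j)
      invFun := fun d =>
        ⟨fun i => d.1.1 i + s fun j => d.2 i j - u j i, fun i => by
          rw [map_add, hs₀, add_zero, d.1.2.1 i]⟩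
      left_inv := fun c => by simp
      right_inv := fun d => by
        obtain ⟨⟨d, hd, hu⟩, y⟩ := d
        simp [hs, hu] }
  rw [Nat.card_congr e, Nat.card_prod]
  congr 1
  simp [Nat.card_eq_fintype_card, hA, ← pow_mul, mul_comm]
end

section
/- Let q be a prime power, m a positive integer, and σ, δ ∈ (0,1) reals with σ < (1−2δ)/2. Let t and d be integers with t even, 4 ≤ t < q, and 1 < d ≤ σq. Then the Reed-Muller code RM(q,d,m) is a (q(q³−1), δ, ε)-locally correctable code, where ε = 8q·(νt/√(q³−1))^t with ν = √8/(1−2σ−2δ). -/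
open scoped BigOperators

/-- A Chernoff bound by counting: for a `[0,1]`-valued function of mean at most `δ` on a finite
type, few `n`-tuples have average at least `δ + a`. -/
theorem card_filter_mean_add_le_exp {V : Type*} [Fintype V] (n : ℕ) (W : V → ℝ)
    (hW0 : ∀ v, 0 ≤ W v) (hW1 : ∀ v, W v ≤ 1) {δ a : ℝ} (hδ1 : δ ≤ 1)
    (ha0 : 0 ≤ a) (ha1 : a ≤ 1) (hmean : ∑ v, W v ≤ δ * Fintype.card V) :
    ((Finset.univ.filter fun v : Fin n → V => n * (δ + a) ≤ ∑ i, W (v i)).card : ℝ) ≤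
      Real.exp (-(n * a ^ 2 / 4)) * (Fintype.card V : ℝ) ^ n := by
  set b := a / 2 with hb
  have hb0 : 0 ≤ b := by positivity
  have hb1 : b ≤ 1 := by linarith
  have hpoint : ∀ v, Real.exp (b * W v) ≤ 1 + (b + b ^ 2) * W v := by
    intro v
    have h0 : 0 ≤ b * W v := mul_nonneg hb0 (hW0 v)
    have h1 : b * W v ≤ 1 := mul_le_one₀ hb1 (hW0 v) (hW1 v)
    have h2 := (abs_le.1 (Real.abs_exp_sub_one_sub_id_le (abs_le.2 ⟨by linarith, h1⟩))).2
    have h3 : W v ^ 2 ≤ W v := by nlinarith [hW0 v, hW1 v]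
    nlinarith [mul_le_mul_of_nonneg_left h3 (sq_nonneg b)]
  have hsum : ∑ v, Real.exp (b * W v) ≤ Fintype.card V * Real.exp ((b + b ^ 2) * δ) := by
    calc ∑ v, Real.exp (b * W v) ≤ ∑ v, (1 + (b + b ^ 2) * W v) :=
          Finset.sum_le_sum fun v _ => hpoint v
      _ = Fintype.card V + (b + b ^ 2) * ∑ v, W v := by
          rw [Finset.sum_add_distrib, Finset.mul_sum]; simp
      _ ≤ Fintype.card V + (b + b ^ 2) * (δ * Fintype.card V) := by gcongr
      _ = Fintype.card V * ((b + b ^ 2) * δ + 1) := by ring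
      _ ≤ _ := by gcongr; exact Real.add_one_le_exp _
  have hmarkov : ((Finset.univ.filter fun v : Fin n → V =>
      n * (δ + a) ≤ ∑ i, W (v i)).card : ℝ) * Real.exp (b * (n * (δ + a))) ≤
      (∑ v, Real.exp (b * W v)) ^ n := by
    have h := Fintype.sum_pow (ι := V) (fun v => Real.exp (b * W v)) n
    rw [h, ← nsmul_eq_mul]
    refine (Finset.card_nsmul_le_sum _ (fun v : Fin n → V => ∏ i, Real.exp (b * W (v i))) _
      ?_).trans (Finset.sum_le_sum_of_subset_of_nonneg (Finset.filter_subset _ _)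
        fun v _ _ => by positivity)
    intro v hv
    rw [← Real.exp_sum, ← Finset.mul_sum]
    have := (Finset.mem_filter.1 hv).2
    gcongr
  have hpow : (∑ v, Real.exp (b * W v)) ^ n ≤
      (Fintype.card V : ℝ) ^ n * Real.exp (n * ((b + b ^ 2) * δ)) := by
    rw [Real.exp_nat_mul, ← mul_pow]
    exact pow_le_pow_left₀ (Finset.sum_nonneg fun v _ => (Real.exp_pos _).le) hsum n
  have hfin : Real.exp (n * ((b + b ^ 2) * δ)) ≤
      Real.exp (-(n * a ^ 2 / 4)) * Real.exp (b * (n * (δ + a))) := by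
    rw [← Real.exp_add, Real.exp_le_exp]
    have h1 : b ^ 2 * δ ≤ b ^ 2 := mul_le_of_le_one_right (sq_nonneg b) hδ1
    have h2 : (b + b ^ 2) * δ ≤ -(a ^ 2 / 4) + b * (δ + a) := by
      have : a = 2 * b := by rw [hb]; ring
      rw [this]; nlinarith
    calc _ ≤ (n : ℝ) * (-(a ^ 2 / 4) + b * (δ + a)) := by gcongr
      _ = _ := by ring
  refine le_of_mul_le_mul_right ?_ (Real.exp_pos (b * (n * (δ + a))))
  calc _ ≤ (Fintype.card V : ℝ) ^ n * Real.exp (n * ((b + b ^ 2) * δ)) := hmarkov.trans hpow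
    _ ≤ (Fintype.card V : ℝ) ^ n *
        (Real.exp (-(n * a ^ 2 / 4)) * Real.exp (b * (n * (δ + a)))) := by gcongr
    _ = _ := by ring

theorem exp_neg_le_div_sq_pow {x : ℝ} (hx : 0 < x) {k : ℕ} (hk : 0 < k) :
    Real.exp (-x) ≤ (2 * (k : ℝ) ^ 2 / x) ^ k := by
  have hk' : (1 : ℝ) ≤ k := by exact_mod_cast hk
  have h1 : Real.exp (-x) = Real.exp (-(x / k)) ^ k := by
    rw [← Real.exp_nat_mul]; congr 1; field_simp
  rw [h1]
  refine pow_le_pow_left₀ (Real.exp_pos _).le ?_ k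
  have h2 : x / k ≤ Real.exp (x / k) := by linarith [Real.add_one_le_exp (x / k)]
  rw [Real.exp_neg]
  calc (Real.exp (x / k))⁻¹ ≤ (x / k)⁻¹ := inv_anti₀ (by positivity) h2
    _ = k / x := inv_div _ _
    _ ≤ _ := by gcongr; nlinarith

section LineDecoding

open Polynomial

variable {F : Type*} [Field F] [Fintype F] [DecidableEq F] {m n : ℕ}

/-- The number of nonzero parameters at which the polynomial `p` disagrees with the word `w` on
the line through `s` in direction `v`. -/
def lineDist (w : (Fin m → F) → F) (s v : Fin m → F) (p : F[X]) : ℕ :=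
  (Finset.univ.filter fun l : F => l ≠ 0 ∧ p.eval l ≠ w (s + l • v)).card

/-- `a` is the common value at `s` of polynomials of degree at most `d` on the lines through `s`
in the directions `v i` whose total disagreement with `w` is below half the minimum distance. -/
def IsLineDecoding (d : ℕ) (s : Fin m → F) (v : Fin n → Fin m → F) (w : (Fin m → F) → F)
    (a : F) : Prop :=
  ∃ p : Fin n → F[X], (∀ i, (p i).natDegree ≤ d) ∧ (∀ i, (p i).eval 0 = a) ∧
    2 * ∑ i, lineDist w s (v i) (p i) + n * d < n * (Fintype.card F - 1)

theorem card_le_lineDist_add {d : ℕ} {w : (Fin m → F) → F} {s v : Fin m → F} {p p' : F[X]}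
    (hp : p.natDegree ≤ d) (hp' : p'.natDegree ≤ d) (h0 : p.eval 0 ≠ p'.eval 0) :
    Fintype.card F - 1 ≤ lineDist w s v p + lineDist w s v p' + d := by
  classical
  have hne : p - p' ≠ 0 := by
    intro h
    exact h0 (by rw [sub_eq_zero.1 h])
  have hroots : (p - p').roots.toFinset.card ≤ d :=
    (Multiset.toFinset_card_le _).trans
      ((card_roots' _).trans ((natDegree_sub_le _ _).trans (max_le hp hp')))
  have hcover : (Finset.univ.erase (0 : F)) ⊆
      ((Finset.univ.filter fun l : F => l ≠ 0 ∧ p.eval l ≠ w (s + l • v)) ∪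
        (Finset.univ.filter fun l : F => l ≠ 0 ∧ p'.eval l ≠ w (s + l • v))) ∪
        (p - p').roots.toFinset := by
    intro l hl
    have hl0 := Finset.ne_of_mem_erase hl
    by_cases h1 : p.eval l = w (s + l • v) <;> by_cases h2 : p'.eval l = w (s + l • v) <;>
      simp [h1, h2, hl0, hne, IsRoot]
  have hcard := Finset.card_le_card hcover
  rw [Finset.card_erase_of_mem (Finset.mem_univ _), Finset.card_univ] at hcard
  refine hcard.trans ((Finset.card_union_le _ _).trans (add_le_add ?_ hroots))
  exact Finset.card_union_le _ _

theorem IsLineDecoding.unique {d : ℕ} {s : Fin m → F} {v : Fin n → Fin m → F}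
    {w : (Fin m → F) → F} {a a' : F} (h : IsLineDecoding d s v w a)
    (h' : IsLineDecoding d s v w a') : a = a' := by
  by_contra hne
  obtain ⟨p, hp, hp0, hpd⟩ := h
  obtain ⟨p', hp', hp0', hpd'⟩ := h'
  have hsum : ∑ _i : Fin n, (Fintype.card F - 1) ≤
      ∑ i, (lineDist w s (v i) (p i) + lineDist w s (v i) (p' i) + d) :=
    Finset.sum_le_sum fun i _ =>
      card_le_lineDist_add (hp i) (hp' i) (by rw [hp0, hp0']; exact hne)
  simp only [Finset.sum_add_distrib, Finset.sum_const, Finset.card_univ, Fintype.card_fin,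
    smul_eq_mul] at hsum
  omega

theorem IsLineDecoding.congr {d : ℕ} {s : Fin m → F} {v : Fin n → Fin m → F}
    {w w' : (Fin m → F) → F} {a : F} (hw : ∀ i, ∀ l : F, w (s + l • v i) = w' (s + l • v i))
    (h : IsLineDecoding d s v w a) : IsLineDecoding d s v w' a := by
  obtain ⟨p, hp, hp0, hpd⟩ := h
  refine ⟨p, hp, hp0, ?_⟩
  simpa only [lineDist, hw] using hpd

/-- The number of nonzero parameters at which `y` and `c` differ on the line through `s` in
direction `v`. -/
def lineErrors (y c : (Fin m → F) → F) (s v : Fin m → F) : ℕ :=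
  (Finset.univ.filter fun l : F => l ≠ 0 ∧ y (s + l • v) ≠ c (s + l • v)).card

theorem isLineDecoding_of_mem_reedMullerCode {d : ℕ} {s : Fin m → F} {v : Fin n → Fin m → F}
    {y c : (Fin m → F) → F} (hc : c ∈ ReedMullerCode F d m)
    (h : 2 * ∑ i, lineErrors y c s (v i) + n * d < n * (Fintype.card F - 1)) :
    IsLineDecoding d s v y (c s) := by
  obtain ⟨f, hf, hfc⟩ := hc
  have heval : ∀ i (l : F),
      (MvPolynomial.aeval (fun j => (C (s j) + X * C (v i j) : F[X])) f).eval l =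
        c (s + l • v i) := by
    intro i l
    rw [← hfc, ← coe_evalRingHom, MvPolynomial.aeval_def, MvPolynomial.hom_eval₂]
    rw [MvPolynomial.eval, MvPolynomial.coe_eval₂Hom]
    congr 1
    · ext; simp
    · ext j; simpa using mul_comm _ _
  refine ⟨fun i => MvPolynomial.aeval (fun j => C (s j) + X * C (v i j)) f, fun i => ?_,
    fun i => ?_, ?_⟩
  · have := MvPolynomial.aeval_natDegree_le f hf (fun j => (C (s j) + X * C (v i j) : F[X]))
      (n := 1) fun j => by compute_degree
    simpa using this
  · rw [heval]; simp
  · convert h using 6 with i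
    simp only [lineDist, lineErrors, heval, ne_comm]

theorem lineErrors_le (y c : (Fin m → F) → F) (s v : Fin m → F) :
    lineErrors y c s v ≤ Fintype.card F - 1 := by
  rw [← Finset.card_univ, ← Finset.card_erase_of_mem (Finset.mem_univ (0 : F))]
  exact Finset.card_le_card fun l hl => by
    simpa using (Finset.mem_filter.1 hl).2.1

theorem sum_lineErrors (y c : (Fin m → F) → F) (s : Fin m → F) :
    ∑ v, lineErrors y c s v = (Fintype.card F - 1) * hammingDist y c := by
  have h1 : ∀ v, lineErrors y c s v =
      ∑ l ∈ Finset.univ.erase (0 : F), if y (s + l • v) ≠ c (s + l • v) then 1 else 0 := by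
    intro v
    rw [lineErrors, ← Finset.card_filter]
    congr 1
    ext l
    simp
  simp_rw [h1]
  rw [Finset.sum_comm]
  have h2 : ∀ l ∈ Finset.univ.erase (0 : F),
      (∑ v : Fin m → F, if y (s + l • v) ≠ c (s + l • v) then 1 else 0) = hammingDist y c := by
    intro l hl
    have hl0 := Finset.ne_of_mem_erase hl
    rw [hammingDist, Finset.card_filter]
    exact Fintype.sum_equiv ((MulAction.toPerm (Units.mk0 l hl0)).trans (Equiv.addLeft s)) _ _
      fun v => by simp [Units.smul_def]
  rw [Finset.sum_congr rfl h2, Finset.sum_const, Finset.card_erase_of_mem (Finset.mem_univ _),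
    Finset.card_univ, smul_eq_mul]

/-- All points of the lines through `s` in the directions `v i`. -/
def linePoints (s : Fin m → F) (v : Fin n → Fin m → F) : Finset (Fin m → F) :=
  Finset.univ.image fun x : F × Fin n => s + x.1 • v x.2

theorem card_linePoints_le (s : Fin m → F) (v : Fin n → Fin m → F) :
    (linePoints s v).card ≤ Fintype.card F * n :=
  Finset.card_image_le.trans (by simp)

open Classical in
/-- Decode the value at `s` from the values on the lines through `s` in the directions `v i`. -/
noncomputable def lineDecode (d : ℕ) (s : Fin m → F) (v : Fin n → Fin m → F)
    (z : ↥(linePoints s v) → F) : F :=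
  if h : ∃ a, IsLineDecoding d s v (fun u => if hu : u ∈ linePoints s v then z ⟨u, hu⟩ else 0) a
  then h.choose else 0

theorem lineDecode_eq {d : ℕ} {s : Fin m → F} {v : Fin n → Fin m → F} {y : (Fin m → F) → F}
    {a : F} (h : IsLineDecoding d s v y a) : lineDecode d s v (fun u => y u.1) = a := by
  have hmem : ∀ i, ∀ l : F, s + l • v i ∈ linePoints s v := fun i l =>
    Finset.mem_image.2 ⟨(l, i), Finset.mem_univ _, rfl⟩
  have h' : IsLineDecoding d s v (fun u => if u ∈ linePoints s v then y u else 0) a :=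
    h.congr fun i l => by simp [hmem]
  have hex : ∃ a, IsLineDecoding d s v
      (fun u => if _ : u ∈ linePoints s v then y u else 0) a := ⟨a, h'⟩
  rw [lineDecode, dif_pos hex]
  exact hex.choose_spec.unique h'

end LineDecoding

/-- Reed-Muller codes are locally correctable by decoding jointly along `n` independent uniform
lines through the point. -/
theorem locallyCorrectable_reedMullerCode {F : Type*} [Field F] [Fintype F] [DecidableEq F]
    (m n d : ℕ) {δ a : ℝ} (hδ1 : δ ≤ 1) (ha0 : 0 ≤ a) (ha1 : a ≤ 1)
    (hd : 2 * (δ + a) * (Fintype.card F - 1) + d ≤ Fintype.card F - 1) :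
    LocallyCorrectable (ReedMullerCode F d m) 1 (Fintype.card F * n) δ
      (Real.exp (-(n * a ^ 2 / 4))) := by
  classical
  intro S hS
  obtain ⟨s, hs⟩ := Finset.card_le_one_iff_subset_singleton.1 hS
  obtain rfl | rfl := Finset.subset_singleton_iff.1 hs
  · refine ⟨PMF.pure ⟨∅, fun _ _ => 0⟩, ?_, ?_⟩
    · intro p hp
      rw [PMF.mem_support_pure_iff] at hp
      simp [hp]
    · intro c _ y _
      rw [PMF.toOuterMeasure_pure_apply, if_pos]
      · exact ENNReal.ofReal_le_one.2 (by linarith [Real.exp_pos (-(n * a ^ 2 / 4))])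
      · exact funext fun x => absurd x.2 (Finset.notMem_empty _)
  · let φ : (Fin n → Fin m → F) →
        ((T : Finset (Fin m → F)) × ((↥T → F) → (↥({s} : Finset (Fin m → F)) → F))) :=
      fun v => ⟨linePoints s v, fun z _ => lineDecode d s v z⟩
    refine ⟨(PMF.uniformOfFintype (Fin n → Fin m → F)).map φ, ?_, ?_⟩
    · intro p hp
      obtain ⟨v, -, rfl⟩ := (PMF.mem_support_map_iff _ _ _).1 hp
      exact card_linePoints_le s v
    · intro c hc y hy
      rw [PMF.toOuterMeasure_map_apply, PMF.toOuterMeasure_uniformOfFintype_apply]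
      have hq : (1 : ℝ) < Fintype.card F := by exact_mod_cast Fintype.one_lt_card
      have hq1 : ((Fintype.card F - 1 : ℕ) : ℝ) = Fintype.card F - 1 := by
        rw [Nat.cast_sub Fintype.card_pos]; simp
      have hq0 : (0 : ℝ) < (Fintype.card F - 1 : ℕ) := by rw [hq1]; linarith
      let W : (Fin m → F) → ℝ := fun v => lineErrors y c s v / (Fintype.card F - 1 : ℕ)
      have hchernoff := card_filter_mean_add_le_exp n W (fun v => by positivity)
        (fun v => (div_le_one hq0).2 (by exact_mod_cast lineErrors_le y c s v)) hδ1 ha0 ha1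
        (by
          rw [← Finset.sum_div, div_le_iff₀ hq0]
          have h := sum_lineErrors y c s
          rw [← Nat.cast_sum, h, Nat.cast_mul]
          nlinarith)
      set B := Finset.univ.filter fun v : Fin n → Fin m → F => n * (δ + a) ≤ ∑ i, W (v i) with hB
      have hgood : Bᶜ ⊆ (φ ⁻¹' {p | p.2 (fun t => y t.1) = fun s => c s.1}).toFinset := by
        intro v hv
        have hv' : ∑ i, W (v i) < n * (δ + a) := by simpa [hB] using hv
        rw [← Finset.sum_div, div_lt_iff₀ hq0, ← Nat.cast_sum] at hv'
        rw [Set.mem_toFinset]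
        funext x
        obtain ⟨x, hx⟩ := x
        obtain rfl := Finset.mem_singleton.1 hx
        refine lineDecode_eq (isLineDecoding_of_mem_reedMullerCode hc ?_)
        have : 2 * ((∑ i, lineErrors y c x (v i) : ℕ) : ℝ) + n * d <
            n * (Fintype.card F - 1 : ℕ) := by
          have h := mul_le_mul_of_nonneg_left hd (Nat.cast_nonneg (α := ℝ) n)
          rw [hq1] at hv' ⊢
          linarith
        exact_mod_cast this
      have hcard := Finset.card_le_card hgood
      rw [Finset.card_compl, Set.toFinset_card] at hcard
      have hV : ((Fintype.card (Fin n → Fin m → F) : ℕ) : ℝ) =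
          (Fintype.card (Fin m → F) : ℝ) ^ n := by
        rw [Fintype.card_fun, Fintype.card_fin]; push_cast; rfl
      have hVpos : (0 : ℝ) < Fintype.card (Fin n → Fin m → F) := by
        exact_mod_cast Fintype.card_pos
      rw [← ENNReal.ofReal_natCast, ← ENNReal.ofReal_natCast, ← ENNReal.ofReal_div_of_pos hVpos]
      refine ENNReal.ofReal_le_ofReal ?_
      rw [le_div_iff₀ hVpos]
      rw [← hV] at hchernoff
      have hcard' := Nat.sub_le_iff_le_add.1 hcard
      have : (Fintype.card (Fin n → Fin m → F) : ℝ) ≤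
          Fintype.card ↑(φ ⁻¹' {p | p.2 (fun t => y t.1) = fun s => c s.1}) + B.card := by
        exact_mod_cast hcard'
      linarith

theorem LocallyCorrectable.mono_error {F I : Type*} [Fintype F] [DecidableEq F] [Fintype I]
    {C : Set (I → F)} {k r : ℕ} {δ ε ε' : ℝ} (h : LocallyCorrectable C k r δ ε) (hε : ε ≤ ε') :
    LocallyCorrectable C k r δ ε' := fun S hS =>
  let ⟨D, hD, hD'⟩ := h S hS
  ⟨D, hD, fun c hc y hy =>
    (ENNReal.ofReal_le_ofReal (sub_le_sub_left hε 1)).trans (hD' c hc y hy)⟩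

theorem stmt_13 (q : ℕ) (F : Type) [Field F] [Fintype F] [DecidableEq F]
    (hF : Fintype.card F = q) (m : ℕ) (hm : 0 < m)
    (σ δ : ℝ) (hσ : σ ∈ Set.Ioo (0 : ℝ) 1) (hδ : δ ∈ Set.Ioo (0 : ℝ) 1)
    (hσδ : σ < (1 - 2 * δ) / 2)
    (t : ℕ) (hteven : Even t) (ht4 : 4 ≤ t) (htq : t < q)
    (d : ℕ) (hd : 1 < d) (hdσ : (d : ℝ) ≤ σ * q) :
    LocallyCorrectable (ReedMullerCode F d m) 1 (q * (q ^ 3 - 1)) δ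
      (8 * (q : ℝ) *
        (Real.sqrt 8 / (1 - 2 * σ - 2 * δ) * t / Real.sqrt ((q : ℝ) ^ 3 - 1)) ^ t) := by
  subst hF
  obtain ⟨hσ0, hσ1⟩ := hσ
  obtain ⟨hδ0, hδ1⟩ := hδ
  have hq : (5 : ℝ) ≤ Fintype.card F := by exact_mod_cast (by omega : 5 ≤ Fintype.card F)
  have hγ : 0 < 1 - 2 * σ - 2 * δ := by linarith
  refine (locallyCorrectable_reedMullerCode m (Fintype.card F ^ 3 - 1) d
    (a := (1 - 2 * σ - 2 * δ) / 2) hδ1.le (by linarith) (by linarith)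
    (by nlinarith)).mono_error ?_
  have hn : ((Fintype.card F ^ 3 - 1 : ℕ) : ℝ) = (Fintype.card F : ℝ) ^ 3 - 1 := by
    rw [Nat.cast_sub (Nat.one_le_pow _ _ Fintype.card_pos)]; push_cast; rfl
  rw [hn]
  have hN : (0 : ℝ) < (Fintype.card F : ℝ) ^ 3 - 1 := by
    have : (5 : ℝ) ^ 3 ≤ (Fintype.card F : ℝ) ^ 3 := by gcongr
    linarith
  generalize (Fintype.card F : ℝ) ^ 3 - 1 = N at hN
  generalize 1 - 2 * σ - 2 * δ = γ at hγ
  obtain ⟨k, rfl⟩ := hteven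
  have hsq : (Real.sqrt 8 / γ * ((k + k : ℕ) : ℝ) / Real.sqrt N) ^ (k + k) =
      (2 * (k : ℝ) ^ 2 / (N * (γ / 2) ^ 2 / 4)) ^ k := by
    rw [← two_mul, pow_mul]
    congr 1
    rw [div_pow, mul_pow, div_pow, Real.sq_sqrt hN.le, Real.sq_sqrt (by norm_num)]
    push_cast
    field_simp
    ring
  rw [hsq]
  have hx : 0 < N * (γ / 2) ^ 2 / 4 := by positivity
  refine (exp_neg_le_div_sq_pow hx (by omega : 0 < k)).trans
    (le_mul_of_one_le_left (by positivity) (by linarith))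
end

section
/- Let q be a prime power, e ≥ 2 an integer, and set n = q^e(q−1) − 1. Let σ, δ ∈ (0,1) be reals with σ < (1−2δ)/4, and let t, d, m be integers with t even, 4 ≤ t ≤ q^e − 4q^{e−1}, 1 < d ≤ σq, and m ≥ 1. Then the Reed-Muller code RM(q,d,m) is a (qn, δ, ε)-locally correctable code, where ε = 8q·((4tδn + 4t²)/((1−4σ−2δ)² n²))^{t/2}. -/
open scoped BigOperators

open Finset in
/-- Hoeffding's lemma for the uniform distribution on a finite type. -/
lemma sum_exp_mul_le {B : Type*} [Fintype B] [Nonempty B] (Y : B → ℝ)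
    (hY : ∀ b, Y b ∈ Set.Icc (0 : ℝ) 1) (μ : ℝ) (hμ : ∑ b, Y b ≤ μ * Fintype.card B)
    (s : ℝ) (hs : 0 ≤ s) :
    ∑ b, Real.exp (s * Y b) ≤ Fintype.card B * Real.exp (s * μ + s ^ 2 / 8) := by
  let _ : MeasurableSpace B := ⊤
  have hcard : (0 : ℝ) < Fintype.card B := by exact_mod_cast Fintype.card_pos
  have hint : ∀ f : B → ℝ, ∫ b, f b ∂(PMF.uniformOfFintype B).toMeasure
      = (∑ b, f b) / Fintype.card B := by
    intro f
    rw [PMF.integral_eq_sum]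
    simp [← Finset.mul_sum, div_eq_inv_mul]
  have h := (ProbabilityTheory.hasSubgaussianMGF_of_mem_Icc
    (μ := (PMF.uniformOfFintype B).toMeasure) (X := Y) (a := 0) (b := 1)
    (measurable_of_finite Y).aemeasurable (Filter.Eventually.of_forall hY)).mgf_le s
  have hc : (((‖(1 : ℝ) - 0‖₊ / 2) ^ 2 : NNReal) : ℝ) * s ^ 2 / 2 = s ^ 2 / 8 := by
    simp
    ring
  rw [hc, ProbabilityTheory.mgf, hint, hint] at h
  simp only [mul_sub, sub_eq_add_neg (s * _), Real.exp_add] at h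
  rw [← Finset.sum_mul, div_le_iff₀ hcard, Real.exp_neg, ← div_eq_mul_inv,
    div_le_iff₀ (Real.exp_pos _)] at h
  have hmean : (∑ b, Y b) / Fintype.card B ≤ μ := by rwa [div_le_iff₀ hcard]
  calc _ ≤ _ := h
    _ = Fintype.card B * Real.exp (s * ((∑ b, Y b) / Fintype.card B) + s ^ 2 / 8) := by
      rw [Real.exp_add]; ring
    _ ≤ _ := by gcongr

open Finset in
/-- Hoeffding's inequality for independent uniform samples from a finite type, in counting form. -/
lemma card_sum_ge_le {B : Type*} [Fintype B] [Nonempty B] (Y : B → ℝ)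
    (hY : ∀ b, Y b ∈ Set.Icc (0 : ℝ) 1) (μ : ℝ) (hμ : ∑ b, Y b ≤ μ * Fintype.card B)
    (a : ℝ) (ha : 0 ≤ a) (n : ℕ) (E : Finset (Fin n → B))
    (hE : ∀ x ∈ E, n * (μ + a / 2) ≤ ∑ i, Y (x i)) :
    (#E : ℝ) ≤ (Fintype.card B : ℝ) ^ n * Real.exp (-(n * a ^ 2 / 2)) := by
  have h1 : (#E : ℝ) * Real.exp (2 * a * (n * (μ + a / 2)))
      ≤ ∑ x : Fin n → B, ∏ i, Real.exp (2 * a * Y (x i)) := by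
    rw [← nsmul_eq_mul, ← Finset.sum_const]
    refine (Finset.sum_le_sum (fun x hx => ?_)).trans
      (Finset.sum_le_univ_sum_of_nonneg (s := E) fun x =>
        Finset.prod_nonneg fun i _ => (Real.exp_pos _).le)
    rw [← Real.exp_sum, ← Finset.mul_sum]
    have := hE x hx
    gcongr
  have h2 := sum_exp_mul_le Y hY μ hμ (2 * a) (by positivity)
  rw [← Fintype.sum_pow (fun b => Real.exp (2 * a * Y b))] at h1
  have h3 := h1.trans (pow_le_pow_left₀
    (Finset.sum_nonneg fun b _ => (Real.exp_pos _).le) h2 n)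
  rw [← le_div_iff₀ (Real.exp_pos _), mul_pow, ← Real.exp_nat_mul, mul_div_assoc,
    ← Real.exp_sub] at h3
  have h4 : n * (2 * a * μ + (2 * a) ^ 2 / 8) - 2 * a * (n * (μ + a / 2))
      = -(n * a ^ 2 / 2) := by ring
  rwa [h4] at h3

open Finset in
lemma card_eval_eq_le {F : Type*} [Field F] [Fintype F] [DecidableEq F] {d : ℕ}
    {p p' : Polynomial F} (hp : p.natDegree ≤ d) (hp' : p'.natDegree ≤ d) (hne : p ≠ p') :
    #{s : Fˣ | p.eval (s : F) = p'.eval (s : F)} ≤ d := by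
  have hsub : p - p' ≠ 0 := sub_ne_zero.2 hne
  calc _ = #(({s : Fˣ | p.eval (s : F) = p'.eval (s : F)} : Finset Fˣ).image Units.val) :=
        (Finset.card_image_of_injective _ Units.val_injective).symm
    _ ≤ #(p - p').roots.toFinset := by
        refine Finset.card_le_card fun x hx => ?_
        simp only [Finset.mem_image, Finset.mem_filter, Finset.mem_univ, true_and] at hx
        obtain ⟨s, hs, rfl⟩ := hx
        simp [hsub, hs]
    _ ≤ (p - p').roots.card := Multiset.toFinset_card_le _
    _ ≤ (p - p').natDegree := Polynomial.card_roots' _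
    _ ≤ d := (Polynomial.natDegree_sub_le _ _).trans (max_le hp hp')

open Finset in
/-- `β` explains the received word `w` on `n` lines: there are polynomials of degree at most `d`
with common value `β` at `0` that disagree with `w` on fewer than half of the guaranteed number of
points at which two families with different values at `0` disagree. -/
def IsDecoding {F : Type*} [Field F] [Fintype F] [DecidableEq F] (d n : ℕ)
    (w : Fin n → Fˣ → F) (β : F) : Prop :=
  ∃ p : Fin n → Polynomial F, (∀ i, (p i).natDegree ≤ d ∧ (p i).eval 0 = β) ∧
    2 * ∑ i, #{s : Fˣ | w i s ≠ (p i).eval (s : F)} < n * (Fintype.card F - 1 - d)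

open Finset in
lemma IsDecoding.unique {F : Type*} [Field F] [Fintype F] [DecidableEq F] {d n : ℕ}
    {w : Fin n → Fˣ → F} {β β' : F} (h : IsDecoding d n w β) (h' : IsDecoding d n w β') :
    β = β' := by
  by_contra hne
  obtain ⟨p, hp, hlt⟩ := h
  obtain ⟨p', hp', hlt'⟩ := h'
  have key : ∀ i, Fintype.card F - 1 - d ≤
      #{s : Fˣ | w i s ≠ (p i).eval (s : F)} + #{s : Fˣ | w i s ≠ (p' i).eval (s : F)} := by
    intro i
    have hpne : p i ≠ p' i := by
      intro h
      apply hne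
      rw [← (hp i).2, ← (hp' i).2, h]
    have h1 := card_eval_eq_le (hp i).1 (hp' i).1 hpne
    have h2 : Fintype.card F - 1 ≤ #{s : Fˣ | (p i).eval (s : F) = (p' i).eval (s : F)}
        + (#{s : Fˣ | w i s ≠ (p i).eval (s : F)} + #{s : Fˣ | w i s ≠ (p' i).eval (s : F)}) := by
      rw [← Fintype.card_units, ← Finset.card_univ]
      refine (Finset.card_le_card ?_).trans ((Finset.card_union_le _ _).trans
        (Nat.add_le_add_left (Finset.card_union_le _ _) _))
      intro s _
      simp only [Finset.mem_union, Finset.mem_filter, Finset.mem_univ, true_and]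
      by_contra! hcon
      exact hcon.1 (hcon.2.1.symm.trans hcon.2.2)
    omega
  have hsum := Finset.sum_le_sum (s := Finset.univ) fun i _ => key i
  rw [Finset.sum_add_distrib] at hsum
  simp only [Finset.sum_const, Finset.card_univ, Fintype.card_fin, smul_eq_mul] at hsum
  omega

/-- The restriction of a polynomial to a parametrized line. -/
lemma exists_polynomial_on_line {F : Type*} [Field F] {m d : ℕ} {f : MvPolynomial (Fin m) F}
    (hf : f.totalDegree ≤ d) (u b : Fin m → F) :
    ∃ p : Polynomial F, p.natDegree ≤ d ∧
      ∀ s, p.eval s = MvPolynomial.eval (u + s • b) f := by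
  refine ⟨MvPolynomial.aeval (fun j => Polynomial.C (u j) + Polynomial.X * Polynomial.C (b j)) f,
    ?_, fun s => ?_⟩
  · have hlin : ∀ j, (Polynomial.C (u j) + Polynomial.X * Polynomial.C (b j)).natDegree ≤ 1 :=
      fun j => by compute_degree
    have h := MvPolynomial.aeval_natDegree_le f hf _ hlin
    rwa [mul_one] at h
  · rw [← Polynomial.coe_aeval_eq_eval, ← MvPolynomial.coe_aeval_eq_eval]
    change ((Polynomial.aeval s : Polynomial F →ₐ[F] F) _) = _
    rw [← AlgHom.comp_apply, MvPolynomial.comp_aeval]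
    simp [Pi.add_def, Pi.smul_def, mul_comm s]

open Finset in
lemma sum_card_line_errors {F : Type*} [Field F] [Fintype F] [DecidableEq F] {m : ℕ}
    (y c : (Fin m → F) → F) (u : Fin m → F) :
    ∑ b : Fin m → F, #{s : Fˣ | y (u + (s : F) • b) ≠ c (u + (s : F) • b)}
      = (Fintype.card F - 1) * hammingDist y c := by
  simp only [Finset.card_filter]
  rw [Finset.sum_comm]
  have : ∀ s : Fˣ, ∑ b : Fin m → F,
      (if y (u + (s : F) • b) ≠ c (u + (s : F) • b) then 1 else 0) = hammingDist y c := by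
    intro s
    rw [hammingDist, Finset.card_filter]
    refine Fintype.sum_equiv ((MulAction.toPerm s).trans (Equiv.addLeft u)) _ _ fun b => ?_
    simp [Units.smul_def]
  rw [Finset.sum_congr rfl fun s _ => this s, Finset.sum_const, Finset.card_univ,
    Fintype.card_units, smul_eq_mul]

lemma log_le_three_eighths_mul {x : ℝ} (hx : 0 < x) : Real.log x ≤ 3 / 8 * x := by
  have h := Real.log_le_sub_one_of_pos (x := x / Real.exp 1) (by positivity)
  rw [Real.log_div hx.ne' (Real.exp_pos _).ne', Real.log_exp] at h
  have h2 : x / Real.exp 1 ≤ 3 / 8 * x := by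
    rw [div_le_iff₀ (Real.exp_pos _)]
    nlinarith [Real.exp_one_gt_d9]
  linarith

lemma exp_neg_le_moment_bound {N t σ δ α : ℝ} {k : ℕ} (hN : 0 < N) (ht : t = 2 * k) (hk : 0 < k)
    (hσ : 0 < σ) (hδ : 0 < δ) (hc : 0 < 1 - 4 * σ - 2 * δ)
    (hα : 1 - 2 * δ - 9 / 8 * σ ≤ α) :
    Real.exp (-(N * α ^ 2 / 2)) ≤
      ((4 * t * δ * N + 4 * t ^ 2) / ((1 - 4 * σ - 2 * δ) ^ 2 * N ^ 2)) ^ k := by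
  set c := 1 - 4 * σ - 2 * δ with hcdef
  have hkR : (0 : ℝ) < k := by exact_mod_cast hk
  have htpos : 0 < t := by rw [ht]; positivity
  set L := c ^ 2 * N ^ 2 / (4 * t * δ * N + 4 * t ^ 2) with hL
  have hLpos : 0 < L := by positivity
  have hlog : Real.log L ≤ N * α ^ 2 / t := by
    rcases le_or_gt (3 / 32) δ with hδ' | hδ'
    · have h1 : L ≤ c ^ 2 * N / (4 * t * δ) := by
        rw [hL, div_le_div_iff₀ (by positivity) (by positivity)]
        have : 0 ≤ c ^ 2 * N * (4 * t ^ 2) := by positivity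
        nlinarith
      have h2 : c ^ 2 ≤ α ^ 2 := by gcongr; linarith
      calc _ ≤ 3 / 8 * L := log_le_three_eighths_mul hLpos
        _ ≤ 3 / 8 * (c ^ 2 * N / (4 * t * δ)) := by gcongr
        _ ≤ N * c ^ 2 / t := by
          rw [← mul_div_assoc, div_le_div_iff₀ (by positivity) (by positivity)]
          have : 0 ≤ c ^ 2 * N * t * (δ - 3 / 32) := by
            have := sub_nonneg.2 hδ'
            positivity
          nlinarith
        _ ≤ _ := by gcongr
    · have h1 : L ≤ (c * N / (2 * t)) ^ 2 := by
        rw [hL, div_pow, div_le_div_iff₀ (by positivity) (by positivity)]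
        have : 0 ≤ c ^ 2 * N ^ 2 * (4 * t * δ * N) := by positivity
        nlinarith
      have h2 : 3 / 8 * c ≤ α ^ 2 := by
        rcases le_or_gt (3 / 8) c with h | h
        · have : c ≤ α := by linarith
          nlinarith
        · have : (1 / 2 : ℝ) ≤ α := by linarith
          nlinarith
      calc Real.log L ≤ Real.log ((c * N / (2 * t)) ^ 2) := Real.log_le_log hLpos h1
        _ = 2 * Real.log (c * N / (2 * t)) := by rw [Real.log_pow]; norm_num
        _ ≤ 2 * (3 / 8 * (c * N / (2 * t))) := by
          gcongr
          exact log_le_three_eighths_mul (by positivity)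
        _ = N * (3 / 8 * c) / t := by field_simp
        _ ≤ _ := by gcongr
  have hinv : (4 * t * δ * N + 4 * t ^ 2) / (c ^ 2 * N ^ 2) = L⁻¹ := by rw [hL, inv_div]
  rw [hinv, ← Real.exp_log (pow_pos (inv_pos.2 hLpos) k), Real.log_pow, Real.log_inv]
  gcongr
  have : k * Real.log L ≤ k * (N * α ^ 2 / t) := by gcongr
  have h3 : k * (N * α ^ 2 / t) = N * α ^ 2 / 2 := by rw [ht]; field_simp
  linarith

open Finset in
/-- All but an exponentially small fraction of the choices of `n` lines through `u` carry few
errors. -/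
lemma card_many_errors_le {F : Type*} [Field F] [Fintype F] [DecidableEq F] {m : ℕ}
    (y c : (Fin m → F) → F) (u : Fin m → F) {δ α : ℝ} (d n : ℕ)
    (hyc : (hammingDist y c : ℝ) ≤ δ * Fintype.card (Fin m → F)) (hα : 0 ≤ α)
    (hd : d ≤ Fintype.card F - 1)
    (hαd : (2 * δ + α) * (Fintype.card F - 1 : ℕ) ≤ (Fintype.card F - 1 : ℕ) - d) :
    (#{a : Fin n → Fin m → F | n * (Fintype.card F - 1 - d) ≤
        2 * ∑ i, #{s : Fˣ | y (u + (s : F) • a i) ≠ c (u + (s : F) • a i)}} : ℝ)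
      ≤ (Fintype.card (Fin m → F) : ℝ) ^ n * Real.exp (-(n * α ^ 2 / 2)) := by
  have hq : (0 : ℝ) < (Fintype.card F - 1 : ℕ) := by
    exact_mod_cast Nat.sub_pos_of_lt Fintype.one_lt_card
  refine card_sum_ge_le
    (fun b => (#{s : Fˣ | y (u + (s : F) • b) ≠ c (u + (s : F) • b)} : ℝ)
      / (Fintype.card F - 1 : ℕ)) (fun b => ⟨by positivity, ?_⟩) δ ?_ α hα n _ ?_
  · rw [div_le_one hq, ← Fintype.card_units]
    exact_mod_cast Finset.card_le_univ _
  · rw [← Finset.sum_div, ← Nat.cast_sum, sum_card_line_errors, Nat.cast_mul,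
      mul_div_cancel_left₀ _ hq.ne']
    exact hyc
  · intro x hx
    rw [Finset.mem_filter] at hx
    rw [← Finset.sum_div, ← Nat.cast_sum, le_div_iff₀ hq]
    have h := (Nat.cast_le (α := ℝ)).2 hx.2
    rw [Nat.cast_mul, Nat.cast_sub hd, Nat.cast_mul] at h
    have h2 := mul_le_mul_of_nonneg_left hαd (Nat.cast_nonneg (α := ℝ) n)
    push_cast at h ⊢
    nlinarith

open Finset in
/-- Reed-Muller codes are locally correctable by jointly decoding along `n` independent random
lines through the point to be corrected. -/
lemma locallyCorrectable_reedMuller {F : Type*} [Field F] [Fintype F] [DecidableEq F]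
    {m d n : ℕ} {δ α ε : ℝ} (hα : 0 ≤ α) (hd : d ≤ Fintype.card F - 1)
    (hαd : (2 * δ + α) * (Fintype.card F - 1 : ℕ) ≤ (Fintype.card F - 1 : ℕ) - d)
    (hε : Real.exp (-(n * α ^ 2 / 2)) ≤ ε) :
    LocallyCorrectable (ReedMullerCode F d m) 1 (Fintype.card F * n) δ ε := by
  classical
  intro S hS
  rcases S.eq_empty_or_nonempty with rfl | ⟨u, hu⟩
  · refine ⟨PMF.pure ⟨∅, fun _ _ => 0⟩, by simp, fun c _ y _ => ?_⟩
    rw [PMF.toOuterMeasure_pure_apply, if_pos]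
    · rw [← ENNReal.ofReal_one]
      exact ENNReal.ofReal_le_ofReal (by linarith [Real.exp_pos (-(n * α ^ 2 / 2))])
    · funext s
      exact absurd s.2 (Finset.notMem_empty _)
  have hSu : ∀ v ∈ S, v = u := fun v hv => Finset.card_le_one.1 hS v hv u hu
  let T : (Fin n → Fin m → F) → Finset (Fin m → F) := fun a =>
    Finset.univ.image fun x : Fˣ × Fin n => u + (x.1 : F) • a x.2
  have hT : ∀ a i (s : Fˣ), u + (s : F) • a i ∈ T a := fun a i s =>
    Finset.mem_image.2 ⟨(s, i), Finset.mem_univ _, rfl⟩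
  let g : ∀ a, (↥(T a) → F) → (↥S → F) := fun a z _ =>
    Classical.epsilon (IsDecoding d n fun i s => z ⟨_, hT a i s⟩)
  refine ⟨(PMF.uniformOfFintype (Fin n → Fin m → F)).map fun a => ⟨T a, g a⟩, ?_, ?_⟩
  · intro p hp
    obtain ⟨a, -, rfl⟩ := (PMF.mem_support_map_iff _ _ _).1 hp
    refine Finset.card_image_le.trans ?_
    rw [Finset.card_univ, Fintype.card_prod, Fintype.card_fin, Fintype.card_units]
    exact Nat.mul_le_mul_right _ (Nat.sub_le _ _)
  · rintro c ⟨f, hf, hfc⟩ y hyc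
    set E : Finset (Fin n → Fin m → F) := {a | n * (Fintype.card F - 1 - d) ≤
      2 * ∑ i, #{s : Fˣ | y (u + (s : F) • a i) ≠ c (u + (s : F) • a i)}} with hE
    have hcardE := card_many_errors_le y c u d n hyc hα hd hαd
    rw [← hE] at hcardE
    have hgood : ∀ a ∉ E, g a (fun t => y t.1) = fun s => c s.1 := by
      intro a ha
      funext s
      have hdec : IsDecoding d n (fun i s => y (u + ((s : Fˣ) : F) • a i)) (c u) := by
        choose p hpd hp using fun i => exists_polynomial_on_line hf u (a i)
        refine ⟨p, fun i => ⟨hpd i, by simp [hp, hfc]⟩, ?_⟩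
        simp only [hp, hfc]
        simpa [hE] using ha
      rw [hSu s.1 s.2]
      exact (Classical.epsilon_spec ⟨_, hdec⟩ : IsDecoding d n _ _).unique hdec
    rw [PMF.toOuterMeasure_map_apply]
    have hsub : ((Eᶜ : Finset _) : Set (Fin n → Fin m → F)) ⊆
        (fun a => (⟨T a, g a⟩ : (T : Finset (Fin m → F)) × ((↥T → F) → (↥S → F)))) ⁻¹'
          {p | p.2 (fun t => y t.1) = fun s => c s.1} := by
      intro a ha
      exact hgood a (by simpa using ha)
    refine le_trans ?_ (MeasureTheory.measure_mono hsub)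
    rw [PMF.toOuterMeasure_uniformOfFintype_apply]
    have hpos : (0 : ℝ) < Fintype.card (Fin n → Fin m → F) := by
      exact_mod_cast Fintype.card_pos
    have hcE : Fintype.card ↥((Eᶜ : Finset _) : Set (Fin n → Fin m → F)) = #Eᶜ :=
      Fintype.card_of_finset' _ fun _ => Iff.rfl
    rw [hcE, ← ENNReal.ofReal_natCast, ← ENNReal.ofReal_natCast, ← ENNReal.ofReal_div_of_pos hpos]
    apply ENNReal.ofReal_le_ofReal
    rw [le_div_iff₀ hpos, Finset.card_compl, Nat.cast_sub (Finset.card_le_univ _)]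
    have hΩ : (Fintype.card (Fin n → Fin m → F) : ℝ) = (Fintype.card (Fin m → F) : ℝ) ^ n := by
      rw [Fintype.card_fun, Fintype.card_fin]
      push_cast
      rfl
    rw [← hΩ] at hcardE
    nlinarith

theorem stmt_14 (q : ℕ) (F : Type) [Field F] [Fintype F] [DecidableEq F]
    (hF : Fintype.card F = q) (e : ℕ) (he : 2 ≤ e) (m : ℕ) (hm : 1 ≤ m)
    (σ δ : ℝ) (hσ : σ ∈ Set.Ioo (0 : ℝ) 1) (hδ : δ ∈ Set.Ioo (0 : ℝ) 1)
    (hσδ : σ < (1 - 2 * δ) / 4)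
    (t : ℕ) (hteven : Even t) (ht4 : 4 ≤ t)
    (htub : (t : ℝ) ≤ (q : ℝ) ^ e - 4 * (q : ℝ) ^ (e - 1))
    (d : ℕ) (hd : 1 < d) (hdσ : (d : ℝ) ≤ σ * q) :
    LocallyCorrectable (ReedMullerCode F d m) 1 (q * (q ^ e * (q - 1) - 1)) δ
      (8 * (q : ℝ) *
        ((4 * t * δ * ((q ^ e * (q - 1) - 1 : ℕ) : ℝ) + 4 * (t : ℝ) ^ 2) /
          ((1 - 4 * σ - 2 * δ) ^ 2 * ((q ^ e * (q - 1) - 1 : ℕ) : ℝ) ^ 2)) ^ (t / 2)) := by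
  obtain ⟨hσ0, hσ1⟩ := hσ
  obtain ⟨hδ0, hδ1⟩ := hδ
  obtain ⟨k, rfl⟩ := hteven
  have hdR : (2 : ℝ) ≤ d := by exact_mod_cast hd
  have hq9 : 9 ≤ q := by
    have : (8 : ℝ) < q := by nlinarith
    exact_mod_cast this
  have hq9R : (9 : ℝ) ≤ q := by exact_mod_cast hq9
  have hqcast : ((q - 1 : ℕ) : ℝ) = q - 1 := by
    rw [Nat.cast_sub (by omega), Nat.cast_one]
  have hN : 0 < q ^ e * (q - 1) - 1 := by
    have h1 : 1 ≤ q ^ e := Nat.one_le_pow _ _ (by omega)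
    have h2 : 8 ≤ q - 1 := by omega
    have := Nat.mul_le_mul h1 h2
    omega
  have hdq : (d : ℝ) ≤ 9 / 8 * σ * (q - 1) := by nlinarith
  have hd' : d ≤ q - 1 := by
    have : (d : ℝ) ≤ (q - 1 : ℕ) := by rw [hqcast]; nlinarith
    exact_mod_cast this
  subst hF
  refine locallyCorrectable_reedMuller (α := 1 - 2 * δ - 9 / 8 * σ) (by linarith) hd' ?_ ?_
  · rw [hqcast]
    linarith
  · have hkk : (k + k) / 2 = k := by omega
    rw [hkk]
    have h := exp_neg_le_moment_bound (t := ((k + k : ℕ) : ℝ)) (k := k) (Nat.cast_pos.2 hN)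
      (by push_cast; ring) (by omega) hσ0 hδ0 (by linarith) (le_refl (1 - 2 * δ - 9 / 8 * σ))
    refine h.trans (le_mul_of_one_le_left ((Real.exp_pos _).le.trans h) (by linarith))
end

section
/- Let q be a prime power, m ≥ 1 an integer, and σ, δ ∈ (0,1) reals with δ < (1−σ)/2. Let k, n, d be positive integers with d > 1, k + n ≤ q, and d < σn/k. Then the Reed-Muller code RM(q,d,m) is a (k; n, δ, 2δ/(1−σ))-locally correctable code. -/
open scoped BigOperators

open Polynomial in
/-- Two polynomials of degree less than `σ n`, each disagreeing with the same word in at most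
`(1 - σ) n / 2` of `n` distinct evaluation points, are equal. -/
theorem Polynomial.eq_of_card_eval_ne_le {F : Type*} [Field F] [DecidableEq F] {n : ℕ} {σ : ℝ}
    {b : Fin n → F} (hb : Function.Injective b) {w : Fin n → F} {g h : F[X]}
    (hg : (g.natDegree : ℝ) < σ * n) (hh : (h.natDegree : ℝ) < σ * n)
    (hgw : ((Finset.univ.filter fun j => w j ≠ g.eval (b j)).card : ℝ) ≤ (1 - σ) * n / 2)
    (hhw : ((Finset.univ.filter fun j => w j ≠ h.eval (b j)).card : ℝ) ≤ (1 - σ) * n / 2) :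
    g = h := by
  set A := Finset.univ.filter fun j => w j ≠ g.eval (b j) with hA
  set B := Finset.univ.filter fun j => w j ≠ h.eval (b j) with hB
  have hcard : (n : ℝ) ≤ ((A ∪ B)ᶜ).card + (A.card + B.card) := by
    have h1 := Finset.card_union_le A B
    have h2 := Finset.card_add_card_compl (A ∪ B)
    rw [Fintype.card_fin] at h2
    exact_mod_cast (by omega : n ≤ ((A ∪ B)ᶜ).card + (A.card + B.card))
  have hlt : σ * n ≤ ((A ∪ B)ᶜ).card := by linarith
  rw [← sub_eq_zero]
  refine Polynomial.eq_zero_of_natDegree_lt_card_of_eval_eq_zero' _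
    (((A ∪ B)ᶜ).image b) ?_ ?_
  · intro x hx
    obtain ⟨j, hj, rfl⟩ := Finset.mem_image.mp hx
    simp only [hA, hB, Finset.mem_compl, Finset.mem_union, Finset.mem_filter, Finset.mem_univ,
      true_and, not_or, not_not] at hj
    rw [Polynomial.eval_sub, ← hj.1, ← hj.2, sub_self]
  · rw [Finset.card_image_of_injective _ hb]
    refine (Polynomial.natDegree_sub_le _ _).trans_lt (max_lt ?_ ?_)
    · exact_mod_cast hg.trans_le hlt
    · exact_mod_cast hh.trans_le hlt

/-- Markov's inequality for a family of injections `φ j` of a finite type: few points `v` have more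
than `τ` of their images `φ j v` in the set defined by `P`. -/
theorem card_filter_lt_card_filter_mul_le {J V : Type*} [Fintype J] [Fintype V]
    {φ : J → V → V} (hφ : ∀ j, Function.Injective (φ j)) (P : V → Prop) [DecidablePred P]
    (τ : ℝ) :
    ((Finset.univ.filter fun v => τ < (Finset.univ.filter fun j => P (φ j v)).card).card : ℝ) * τ
      ≤ Fintype.card J * (Finset.univ.filter P).card := by
  classical
  have hsum : ∑ v, (Finset.univ.filter fun j => P (φ j v)).card
      ≤ Fintype.card J * (Finset.univ.filter P).card := by
    calc ∑ v, (Finset.univ.filter fun j => P (φ j v)).card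
        = ∑ j, (Finset.univ.filter fun v => P (φ j v)).card := by
          simp only [Finset.card_filter]
          exact Finset.sum_comm
      _ ≤ ∑ _j : J, (Finset.univ.filter P).card := by
          refine Finset.sum_le_sum fun j _ => ?_
          refine Finset.card_le_card_of_injOn (φ j) ?_ (hφ j).injOn
          intro v hv
          simpa using hv
      _ = _ := by simp
  calc ((Finset.univ.filter fun v =>
          τ < (Finset.univ.filter fun j => P (φ j v)).card).card : ℝ) * τ
      = ∑ v ∈ Finset.univ.filter fun v => τ < (Finset.univ.filter fun j => P (φ j v)).card, τ := by
        simp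
    _ ≤ ∑ v ∈ Finset.univ.filter fun v => τ < (Finset.univ.filter fun j => P (φ j v)).card,
          ((Finset.univ.filter fun j => P (φ j v)).card : ℝ) :=
        Finset.sum_le_sum fun v hv => (Finset.mem_filter.mp hv).2.le
    _ ≤ ∑ v, ((Finset.univ.filter fun j => P (φ j v)).card : ℝ) :=
        Finset.sum_le_sum_of_subset_of_nonneg (Finset.filter_subset _ _)
          fun _ _ _ => Nat.cast_nonneg _
    _ ≤ _ := by exact_mod_cast hsum

open Polynomial in
theorem MvPolynomial.eval_aeval_polynomial {R ι : Type*} [CommSemiring R]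
    (f : MvPolynomial ι R) (P : ι → R[X]) (t : R) :
    (MvPolynomial.aeval P f).eval t = MvPolynomial.eval (fun i => (P i).eval t) f := by
  induction f using MvPolynomial.induction_on with
  | C a => simp
  | add p q hp hq => simp [hp, hq]
  | mul_X p i hp => simp [hp]

theorem PMF.ofReal_le_toOuterMeasure_map_uniformOfFintype {α β : Type*} [Fintype α] [Nonempty α]
    (φ : α → β) (s : Set β) (G : Finset α) (hG : ∀ v ∈ G, φ v ∈ s) {p : ℝ}
    (hp : p * Fintype.card α ≤ G.card) :
    ENNReal.ofReal p ≤ ((PMF.uniformOfFintype α).map φ).toOuterMeasure s := by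
  classical
  rw [PMF.toOuterMeasure_map_apply]
  refine le_trans ?_ (MeasureTheory.measure_mono (show (G : Set α) ⊆ φ ⁻¹' s from hG))
  rw [PMF.toOuterMeasure_uniformOfFintype_apply, ENNReal.le_div_iff_mul_le (by simp) (by simp),
    ← ENNReal.ofReal_natCast, ← ENNReal.ofReal_mul' (Nat.cast_nonneg _)]
  refine ENNReal.ofReal_le_of_le_toReal ?_
  simpa using hp

section Curve

open Polynomial

variable {F ι κ : Type*} [Field F] [Fintype κ] [DecidableEq κ]

/-- The curve with direction `v` that passes through the point `x s` at time `a s`, for every `s`.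
-/
noncomputable def interpolatingCurve (a : κ → F) (x : κ → ι → F) (v : ι → F) (i : ι) : F[X] :=
  Lagrange.interpolate Finset.univ a (fun s => x s i) + C (v i) * Lagrange.nodal Finset.univ a

theorem natDegree_interpolatingCurve_le {a : κ → F} (ha : Function.Injective a)
    (x : κ → ι → F) (v : ι → F) (i : ι) :
    (interpolatingCurve a x v i).natDegree ≤ Fintype.card κ := by
  refine Polynomial.natDegree_add_le_of_degree_le ?_ ?_
  · exact Polynomial.natDegree_le_of_degree_le
      (Lagrange.degree_interpolate_lt _ ha.injOn).le
  · refine (Polynomial.natDegree_C_mul_le _ _).trans ?_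
    rw [Lagrange.natDegree_nodal, Finset.card_univ]

theorem eval_interpolatingCurve_node {a : κ → F} (ha : Function.Injective a)
    (x : κ → ι → F) (v : ι → F) (i : ι) (s : κ) :
    (interpolatingCurve a x v i).eval (a s) = x s i := by
  rw [interpolatingCurve, Polynomial.eval_add, Polynomial.eval_mul,
    Lagrange.eval_interpolate_at_node _ ha.injOn (Finset.mem_univ s),
    Lagrange.eval_nodal_at_node (Finset.mem_univ s), mul_zero, add_zero]

theorem eval_interpolatingCurve_injective {a : κ → F} (x : κ → ι → F) {t : F}
    (ht : ∀ s, t ≠ a s) :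
    Function.Injective fun v i => (interpolatingCurve a x v i).eval t := by
  intro v v' h
  funext i
  have hi := congrFun h i
  have h0 : (Lagrange.nodal Finset.univ a).eval t ≠ 0 :=
    Lagrange.eval_nodal_not_at_node fun s _ => ht s
  simpa [interpolatingCurve, h0] using hi

end Curve

open Polynomial in
/-- Evaluations at the points `a s` of some polynomial of degree less than `σ n` that disagrees with
the word `w` in at most `(1 - σ) n / 2` of the points `b j`, if there is one. -/
noncomputable def decodeAt {F κ : Type*} [Field F] [DecidableEq F] {n : ℕ} (σ : ℝ) (a : κ → F)
    (b : Fin n → F) (w : Fin n → F) (s : κ) : F :=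
  (Classical.epsilon fun h : F[X] => (h.natDegree : ℝ) < σ * n ∧
    ((Finset.univ.filter fun j => w j ≠ h.eval (b j)).card : ℝ) ≤ (1 - σ) * n / 2).eval (a s)

open Polynomial in
theorem decodeAt_eq {F κ : Type*} [Field F] [DecidableEq F] {n : ℕ} {σ : ℝ} (a : κ → F)
    {b : Fin n → F} (hb : Function.Injective b) {w : Fin n → F} {h : F[X]}
    (hh : (h.natDegree : ℝ) < σ * n)
    (hhw : ((Finset.univ.filter fun j => w j ≠ h.eval (b j)).card : ℝ) ≤ (1 - σ) * n / 2) (s : κ) :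
    decodeAt σ a b w s = h.eval (a s) := by
  have hspec := Classical.epsilon_spec (p := fun h : F[X] => (h.natDegree : ℝ) < σ * n ∧
    ((Finset.univ.filter fun j => w j ≠ h.eval (b j)).card : ℝ) ≤ (1 - σ) * n / 2) ⟨h, hh, hhw⟩
  rw [decodeAt, Polynomial.eq_of_card_eval_ne_le hb hspec.1 hh hspec.2 hhw]

theorem stmt_15 (q : ℕ) (F : Type) [Field F] [Fintype F] [DecidableEq F]
    (hF : Fintype.card F = q) (m : ℕ) (hm : 1 ≤ m)
    (σ δ : ℝ) (hσ : σ ∈ Set.Ioo (0 : ℝ) 1) (hδ : δ ∈ Set.Ioo (0 : ℝ) 1)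
    (hδσ : δ < (1 - σ) / 2)
    (k n d : ℕ) (hk : 0 < k) (hn : 0 < n) (hd : 1 < d)
    (hkn : k + n ≤ q) (hdσ : (d : ℝ) < σ * n / k) :
    LocallyCorrectable (ReedMullerCode F d m) k n δ (2 * δ / (1 - σ)) := by
  intro S hS
  obtain ⟨e⟩ : Nonempty (↥S ⊕ Fin n ↪ F) := by
    refine Function.Embedding.nonempty_of_card_le ?_
    rw [Fintype.card_sum, Fintype.card_coe, Fintype.card_fin, hF]
    omega
  set a : ↥S → F := fun s => e (Sum.inl s) with ha_def
  set b : Fin n → F := fun j => e (Sum.inr j) with hb_def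
  have ha : Function.Injective a := e.injective.comp Sum.inl_injective
  have hb : Function.Injective b := e.injective.comp Sum.inr_injective
  have hab : ∀ j s, b j ≠ a s := fun j s h => by simpa using e.injective h
  set x : ↥S → Fin m → F := Subtype.val
  set φ : Fin n → (Fin m → F) → (Fin m → F) :=
    fun j v i => (interpolatingCurve a x v i).eval (b j) with hφ_def
  have hφ : ∀ j, Function.Injective (φ j) := fun j => eval_interpolatingCurve_injective x (hab j)
  refine ⟨(PMF.uniformOfFintype (Fin m → F)).map fun v =>
    ⟨Finset.univ.image fun j => φ j v, fun y => decodeAt σ a b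
      fun j => y ⟨φ j v, Finset.mem_image_of_mem _ (Finset.mem_univ j)⟩⟩, ?_, ?_⟩
  · intro p hp
    obtain ⟨v, -, rfl⟩ := (PMF.mem_support_map_iff _ _ _).mp hp
    exact Finset.card_image_le.trans (by simp)
  · rintro c ⟨f, hf, hfc⟩ y hy
    refine PMF.ofReal_le_toOuterMeasure_map_uniformOfFintype _ _
      (Finset.univ.filter fun v => ¬ (1 - σ) * n / 2 <
        (Finset.univ.filter fun j => y (φ j v) ≠ c (φ j v)).card) ?_ ?_
    · intro v hv
      have hv' := not_lt.mp (Finset.mem_filter.mp hv).2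
      have heval : ∀ t, (MvPolynomial.aeval (interpolatingCurve a x v) f).eval t =
          c fun i => (interpolatingCurve a x v i).eval t := fun t => by
        rw [MvPolynomial.eval_aeval_polynomial, hfc]
      funext s
      refine (decodeAt_eq a hb (h := MvPolynomial.aeval (interpolatingCurve a x v) f)
        ?_ ?_ s).trans ?_
      · have hdeg : (MvPolynomial.aeval (interpolatingCurve a x v) f).natDegree ≤ d * k :=
          f.aeval_natDegree_le hf _ fun i =>
            (natDegree_interpolatingCurve_le ha x v i).trans (by simpa using hS)
        have hdk : (d * k : ℝ) < σ * n := (lt_div_iff₀ (by exact_mod_cast hk)).mp hdσ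
        exact lt_of_le_of_lt (by exact_mod_cast hdeg) hdk
      · simpa only [heval] using hv'
      · rw [heval]
        congr 1
        funext i
        exact eval_interpolatingCurve_node ha x v i s
    · have hmarkov := card_filter_lt_card_filter_mul_le hφ (fun u => y u ≠ c u)
        ((1 - σ) * n / 2)
      have hsplit := Finset.card_filter_add_card_filter_not (s := Finset.univ)
        (fun v => (1 - σ) * n / 2 <
          ((Finset.univ.filter fun j => y (φ j v) ≠ c (φ j v)).card : ℝ))
      set B := Finset.univ.filter fun v => (1 - σ) * n / 2 <
          ((Finset.univ.filter fun j => y (φ j v) ≠ c (φ j v)).card : ℝ)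
      have hsplit' := congrArg (Nat.cast (R := ℝ)) hsplit
      rw [Nat.cast_add, Finset.card_univ] at hsplit'
      have hσ' : 0 < 1 - σ := by linarith [hσ.2]
      have hn' : (0 : ℝ) < n := by exact_mod_cast hn
      change ((Finset.univ.filter fun u => y u ≠ c u).card : ℝ) ≤ _ at hy
      have hB : (B.card : ℝ) ≤ 2 * δ / (1 - σ) * Fintype.card (Fin m → F) := by
        rw [div_mul_eq_mul_div, le_div_iff₀ hσ']
        rw [Fintype.card_fin] at hmarkov
        have h2 := mul_le_mul_of_nonneg_left hy hn'.le
        refine le_of_mul_le_mul_right ?_ hn'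
        linarith
      linarith
end
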